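/- (Main result) For every positive integer n ≤ 6, every cube tiling of ℝⁿ contains a column; that is, if T ⊆ ℝⁿ determines a cube tiling of ℝⁿ and n ≤ 6, then there exist s ∈ ℝⁿ and a standard basis vector eᵢ of ℝⁿ such that s + k·eᵢ ∈ T for every k ∈ ℤ. -/

import Mathlib

/-- The half-open unit cube `[0,1)ⁿ` translated by `t`. -/
def Cube {n : ℕ} (t : Fin n → ℝ) : Set (Fin n → ℝ) :=
  {x | ∀ j, t j ≤ x j ∧ x j < t j + 1}

/-- `T` determines a cube tiling of `ℝⁿ`: the cubes `[0,1)ⁿ + t`, `t ∈ T`,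
are pairwise disjoint and their union is all of `ℝⁿ`. -/
def IsCubeTiling {n : ℕ} (T : Set (Fin n → ℝ)) : Prop :=
  (∀ s ∈ T, ∀ t ∈ T, s ≠ t → Disjoint (Cube s) (Cube t)) ∧
  (⋃ t ∈ T, Cube t) = Set.univ

/-- `T ⊆ ℝ` determines a tiling of `ℝ` by unit intervals `[0,1) + t`. -/
def IsCubeTiling1 (T : Set ℝ) : Prop :=
  (∀ s ∈ T, ∀ t ∈ T, s ≠ t → Disjoint (Set.Ico s (s + 1)) (Set.Ico t (t + 1))) ∧
  (⋃ t ∈ T, Set.Ico t (t + 1)) = Set.univ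

/-- The tiling determined by `T` contains a column: there are `s ∈ ℝⁿ` and a
standard basis vector `eᵢ` such that `s + k·eᵢ ∈ T` for every `k ∈ ℤ`. -/
def ContainsColumn {n : ℕ} (T : Set (Fin n → ℝ)) : Prop :=
  ∃ s : Fin n → ℝ, ∃ i : Fin n, ∀ k : ℤ, (s + (k : ℝ) • (Pi.single i 1 : Fin n → ℝ)) ∈ T

/-- A natural code of `ℝⁿ`: each `ε j : ℝ → ℕ⁺` restricts to a bijection from
every coset `x + ℤ` onto the positive integers. -/
def IsNaturalCode {n : ℕ} (ε : Fin n → ℝ → ℕ+) : Prop :=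
  ∀ j : Fin n, ∀ x : ℝ, Set.BijOn (ε j) {y : ℝ | ∃ m : ℤ, y = x + m} Set.univ

namespace Kel

@[ext] structure P where
  l : ℝ
  a : ℤ

abbrev O := Option P
abbrev S := ℝ → ℤ

class Pce (Q : Type) where
  m : Q → S → Prop
  sep : Q → Q → Prop
  ln : ℝ → ℤ → Q

instance instPceP : Pce P where
  m p σ := σ p.l = p.a
  sep p q := p.l = q.l ∧ p.a ≠ q.a
  ln l a := ⟨l, a⟩

instance instPceO : Pce O where
  m u σ := ∀ p, u = some p → σ p.l = p.a
  sep u v := ∃ p q, u = some p ∧ v = some q ∧ p.l = q.l ∧ p.a ≠ q.a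
  ln l a := some ⟨l, a⟩

open Pce

@[simp] theorem mP (p : P) (σ : S) : m p σ ↔ σ p.l = p.a := Iff.rfl
@[simp] theorem sepP (p q : P) : sep p q ↔ p.l = q.l ∧ p.a ≠ q.a := Iff.rfl
@[simp] theorem lnP (l : ℝ) (a : ℤ) : (ln l a : P) = ⟨l, a⟩ := rfl
@[simp] theorem lnO (l : ℝ) (a : ℤ) : (ln l a : O) = some ⟨l, a⟩ := rfl
@[simp] theorem mO_none (σ : S) : m (none : O) σ ↔ True := by
  simp [m]
@[simp] theorem mO_some (p : P) (σ : S) : m (some p : O) σ ↔ σ p.l = p.a := by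
  simp [m]
@[simp] theorem sepO_none_left (u : O) : sep (none : O) u ↔ False := by
  simp [sep]
@[simp] theorem sepO_none_right (u : O) : sep u (none : O) ↔ False := by
  simp [sep]
@[simp] theorem sepO_some (p q : P) : sep (some p : O) (some q : O) ↔ p.l = q.l ∧ p.a ≠ q.a := by
  simp [sep]

theorem sepO_symm {u v : O} (h : sep u v) : sep v u := by
  obtain ⟨p, q, h1, h2, h3, h4⟩ := h
  exact ⟨q, p, h2, h1, h3.symm, h4.symm⟩

theorem sepP_symm {u v : P} (h : sep u v) : sep v u := ⟨h.1.symm, fun e => h.2 e.symm⟩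

theorem notsepO {u v : O} {σ : S} (hu : m u σ) (hv : m v σ) : ¬ sep u v := by
  rintro ⟨p, q, h1, h2, h3, h4⟩
  have := hu p h1; have := hv q h2
  apply h4; rw [← hu p h1, ← hv q h2, h3]

theorem notsepP {u v : P} {σ : S} (hu : m u σ) (hv : m v σ) : ¬ sep u v := by
  rintro ⟨h3, h4⟩
  simp only [mP] at hu hv
  apply h4; rw [← hu, ← hv, h3]

theorem commonO {u v : O} (h : ¬ sep u v) : ∃ σ : S, m u σ ∧ m v σ := by
  classical
  rcases u with _ | p
  · rcases v with _ | q
    · exact ⟨fun _ => 0, by simp⟩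
    · exact ⟨fun _ => q.a, by simp⟩
  · rcases v with _ | q
    · exact ⟨fun _ => p.a, by simp⟩
    · refine ⟨fun l => if l = p.l then p.a else q.a, by simp, ?_⟩
      by_cases e : q.l = p.l
      · simp only [sepO_some, not_and, not_not] at h
        simp [e, h e.symm]
      · simp [e]

theorem commonP {u v : P} (h : ¬ sep u v) : ∃ σ : S, m u σ ∧ m v σ := by
  classical
  refine ⟨fun l => if l = u.l then u.a else v.a, by simp, ?_⟩
  by_cases e : v.l = u.l
  · simp only [sepP, not_and, not_not] at h
    simp [e, h e.symm]
  · simp [e]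

/-- if `u` is separated from `(a,p0)` and contains `σ` then `u = (a, σ a)`. -/
theorem sep_some {u : O} {p : P} {σ : S} (h : sep u (some p)) (hm : m u σ) :
    u = some ⟨p.l, σ p.l⟩ ∧ σ p.l ≠ p.a := by
  obtain ⟨p', q, rfl, h2, h3, h4⟩ := h
  simp only [Option.some.injEq] at h2
  subst h2
  simp only [mO_some] at hm
  refine ⟨?_, ?_⟩
  · congr 1; ext
    · exact h3
    · simp [← h3, hm]
  · rw [← h3, hm]; exact h4

theorem sep_someP {u p : P} {σ : S} (h : sep u p) (hm : m u σ) :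
    u = ⟨p.l, σ p.l⟩ ∧ σ p.l ≠ p.a := by
  obtain ⟨h3, h4⟩ := h
  simp only [mP] at hm
  refine ⟨?_, ?_⟩
  · ext
    · exact h3
    · simp [← h3, hm]
  · rw [← h3, hm]; exact h4

/-! ### curried tilings -/

structure Til1 (C : O → Prop) : Prop where
  ex : ∀ s, ∃ u, C u ∧ m u s
  sp : ∀ u v, C u → C v → sep u v ∨ u = v

structure Til2 (C : O → O → Prop) : Prop where
  ex : ∀ s1 s2, ∃ u1 u2, C u1 u2 ∧ m u1 s1 ∧ m u2 s2
  sp : ∀ u1 u2 v1 v2, C u1 u2 → C v1 v2 → sep u1 v1 ∨ sep u2 v2 ∨ (u1 = v1 ∧ u2 = v2)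

structure Til3 (C : O → O → O → Prop) : Prop where
  ex : ∀ s1 s2 s3, ∃ u1 u2 u3, C u1 u2 u3 ∧ m u1 s1 ∧ m u2 s2 ∧ m u3 s3
  sp : ∀ u1 u2 u3 v1 v2 v3, C u1 u2 u3 → C v1 v2 v3 →
    sep u1 v1 ∨ sep u2 v2 ∨ sep u3 v3 ∨ (u1 = v1 ∧ u2 = v2 ∧ u3 = v3)

structure Til4 (C : O → O → O → O → Prop) : Prop where
  ex : ∀ s1 s2 s3 s4, ∃ u1 u2 u3 u4, C u1 u2 u3 u4 ∧ m u1 s1 ∧ m u2 s2 ∧ m u3 s3 ∧ m u4 s4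
  sp : ∀ u1 u2 u3 u4 v1 v2 v3 v4, C u1 u2 u3 u4 → C v1 v2 v3 v4 →
    sep u1 v1 ∨ sep u2 v2 ∨ sep u3 v3 ∨ sep u4 v4 ∨ (u1 = v1 ∧ u2 = v2 ∧ u3 = v3 ∧ u4 = v4)

def NC1 (C : O → Prop) : Prop := ∀ l, ∃ a, ¬ C (some ⟨l, a⟩)
structure NC2 (C : O → O → Prop) : Prop where
  c1 : ∀ u l, ∃ a, ¬ C (some ⟨l, a⟩) u
  c2 : ∀ u l, ∃ a, ¬ C u (some ⟨l, a⟩)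
structure NC3 (C : O → O → O → Prop) : Prop where
  c1 : ∀ u v l, ∃ a, ¬ C (some ⟨l, a⟩) u v
  c2 : ∀ u v l, ∃ a, ¬ C u (some ⟨l, a⟩) v
  c3 : ∀ u v l, ∃ a, ¬ C u v (some ⟨l, a⟩)
structure NC4 (C : O → O → O → O → Prop) : Prop where
  c1 : ∀ u v w l, ∃ a, ¬ C (some ⟨l, a⟩) u v w
  c2 : ∀ u v w l, ∃ a, ¬ C u (some ⟨l, a⟩) v w
  c3 : ∀ u v w l, ∃ a, ¬ C u v (some ⟨l, a⟩) w
  c4 : ∀ u v w l, ∃ a, ¬ C u v w (some ⟨l, a⟩)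

/-- Existence alone is enough on points: one-dimensional families. -/
theorem L1 {C : O → Prop} (h : Til1 C) : C none ∨ ∃ l, ∀ a, C (some ⟨l, a⟩) := by
  classical
  obtain ⟨u, hu, -⟩ := h.ex (fun _ => 0)
  rcases u with _ | ⟨l, a0⟩
  · exact Or.inl hu
  · refine Or.inr ⟨l, fun a => ?_⟩
    by_cases e : a = a0
    · rw [e]; exact hu
    obtain ⟨v, hv, hm⟩ := h.ex (fun _ => a)
    rcases h.sp _ _ hv hu with h1 | h1
    · have := (sep_some h1 hm).1
      simp only at this
      rw [this] at hv; exact hv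
    · rw [h1] at hm
      simp at hm
      exact absurd hm e

theorem L1' {C : O → Prop} (h : Til1 C) (hn : NC1 C) : C none := by
  rcases L1 h with h | ⟨l, hl⟩
  · exact h
  · obtain ⟨a, ha⟩ := hn l
    exact absurd (hl a) ha

/-- layered structure of two dimensional tilings. -/
theorem L2lay {C : O → O → Prop} (h : Til2 C) : C none none ∨
    (∃ x, ∀ u v, C u v → ∃ p, u = some ⟨x, p⟩) ∨ (∃ y, ∀ u v, C u v → ∃ p, v = some ⟨y, p⟩) := by
  by_contra hc
  push Not at hc
  obtain ⟨h0, h1, h2⟩ := hc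
  obtain ⟨u, v, huv, -, -⟩ := h.ex (fun _ => 0) (fun _ => 0)
  have key : ∀ (u : O) x p, sep u (some ⟨x, p⟩) → ∃ p', u = some ⟨x, p'⟩ := by
    rintro u x p ⟨p1, q, rfl, h2, h3, h4⟩
    simp only [Option.some.injEq] at h2
    subst h2
    exact ⟨p1.a, by congr 1; ext <;> simp [h3]⟩
  rcases u with _ | ⟨x, p⟩
  · rcases v with _ | ⟨y, q⟩
    · exact h0 huv
    · obtain ⟨u', v', huv', hne⟩ := h2 y
      rcases h.sp _ _ _ _ huv' huv with a | a | a
      · simp at a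
      · obtain ⟨q', e⟩ := key _ _ _ a
        exact hne _ e
      · exact hne _ a.2
  · rcases v with _ | ⟨y, q⟩
    · obtain ⟨u', v', huv', hne⟩ := h1 x
      rcases h.sp _ _ _ _ huv' huv with a | a | a
      · obtain ⟨q', e⟩ := key _ _ _ a
        exact hne _ e
      · simp at a
      · exact hne _ a.1
    · obtain ⟨u', v', huv', hne⟩ := h1 x
      obtain ⟨u2, v2, huv2, hne2⟩ := h2 y
      have e1 : ∃ q', v' = some ⟨y, q'⟩ := by
        rcases h.sp _ _ _ _ huv' huv with a | a | a
        · obtain ⟨q', e⟩ := key _ _ _ a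
          exact absurd e (hne _)
        · exact key _ _ _ a
        · exact absurd a.1 (hne _)
      have e2 : ∃ q', u2 = some ⟨x, q'⟩ := by
        rcases h.sp _ _ _ _ huv2 huv with a | a | a
        · exact key _ _ _ a
        · obtain ⟨q', e⟩ := key _ _ _ a
          exact absurd e (hne2 _)
        · exact absurd a.2 (hne2 _)
      obtain ⟨q', rfl⟩ := e1
      obtain ⟨p', rfl⟩ := e2
      rcases h.sp _ _ _ _ huv' huv2 with a | a | a
      · obtain ⟨q', e⟩ := key _ _ _ a
        exact absurd e (hne _)
      · obtain ⟨q', e⟩ := key _ _ _ (sepO_symm a)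
        exact absurd e (hne2 _)
      · exact absurd a.1 (hne _)

theorem L2 {C : O → O → Prop} (h : Til2 C) (hn : NC2 C) : C none none := by
  rcases L2lay h with h0 | ⟨x, hx⟩ | ⟨y, hy⟩
  · exact h0
  · exfalso
    have : ∀ p, C (some ⟨x, p⟩) none := by
      intro p
      refine L1' (C := fun v => C (some ⟨x, p⟩) v) ⟨?_, ?_⟩ (fun l => hn.c2 _ l)
      · intro s
        obtain ⟨u, v, huv, m1, m2⟩ := h.ex (fun _ => p) s
        obtain ⟨p', rfl⟩ := hx _ _ huv
        simp only [mO_some] at m1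
        subst m1
        exact ⟨v, huv, m2⟩
      · intro u v hu hv
        rcases h.sp _ _ _ _ hu hv with a | a | a
        · simp at a
        · exact Or.inl a
        · exact Or.inr a.2
    obtain ⟨a, ha⟩ := hn.c1 none x
    exact ha (this a)
  · exfalso
    have : ∀ p, C none (some ⟨y, p⟩) := by
      intro p
      refine L1' (C := fun v => C v (some ⟨y, p⟩)) ⟨?_, ?_⟩ (fun l => hn.c1 _ l)
      · intro s
        obtain ⟨u, v, huv, m1, m2⟩ := h.ex s (fun _ => p)
        obtain ⟨p', rfl⟩ := hy _ _ huv
        simp only [mO_some] at m2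
        subst m2
        exact ⟨u, huv, m1⟩
      · intro u v hu hv
        rcases h.sp _ _ _ _ hu hv with a | a | a
        · exact Or.inl a
        · simp at a
        · exact Or.inr a.1
    obtain ⟨a, ha⟩ := hn.c2 none y
    exact ha (this a)

end Kel

namespace Kel
open Pce

def TilF {n : ℕ} {Q : Type} [Pce Q] (T : (Fin n → Q) → Prop) : Prop :=
  (∀ σ : Fin n → S, ∃ x, T x ∧ ∀ i, m (x i) (σ i)) ∧
  (∀ x y, T x → T y → x = y ∨ ∃ i, sep (x i) (y i))

def NoColF {n : ℕ} {Q : Type} [Pce Q] (T : (Fin n → Q) → Prop) : Prop :=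
  ∀ x i l, ∃ a, ¬ T (Function.update x i (ln l a))

def PermF {n : ℕ} {Q : Type} (π : Equiv.Perm (Fin n)) (T : (Fin n → Q) → Prop) :
    (Fin n → Q) → Prop := fun x => T (fun i => x (π i))

theorem TilF.perm {n : ℕ} {Q : Type} [Pce Q] {T : (Fin n → Q) → Prop} (h : TilF T)
    (π : Equiv.Perm (Fin n)) : TilF (PermF π T) := by
  refine ⟨fun σ => ?_, fun x y hx hy => ?_⟩
  · obtain ⟨x, hx, hm⟩ := h.1 (fun i => σ (π i))
    refine ⟨fun i => x (π.symm i), ?_, fun i => ?_⟩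
    · simpa [PermF] using hx
    · have := hm (π.symm i)
      simpa using this
  · rcases h.2 _ _ hx hy with e | ⟨i, hi⟩
    · left; funext i
      have := congrFun e (π.symm i)
      simpa using this
    · exact Or.inr ⟨_, hi⟩

theorem NoColF.perm {n : ℕ} {Q : Type} [Pce Q] {T : (Fin n → Q) → Prop} (h : NoColF T)
    (π : Equiv.Perm (Fin n)) : NoColF (PermF π T) := by
  intro x i l
  obtain ⟨a, ha⟩ := h (fun j => x (π j)) (π.symm i) l
  refine ⟨a, fun hc => ha ?_⟩
  unfold PermF at hc
  convert hc using 1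
  funext j
  by_cases e : j = π.symm i
  · subst e; simp
  · have : π j ≠ i := fun e' => e (by rw [← e']; simp)
    simp [Function.update_of_ne e, Function.update_of_ne this]

/-- family `F` near the cell `K`, in relative pieces. -/
def Rel {n : ℕ} (F : (Fin n → P) → Prop) (K : Fin n → P) (u : Fin n → O) : Prop :=
  F (fun i => (u i).getD (K i)) ∧ ∀ i p, u i = some p → p.l ≠ (K i).l

def LocTil {n : ℕ} (F : (Fin n → P) → Prop) (K : Fin n → P) : Prop :=
  (∀ σ : Fin n → S, (∀ i, m (K i) (σ i)) → ∃ x, F x ∧ ∀ i, m (x i) (σ i)) ∧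
  (∀ x y, F x → F y → x = y ∨ ∃ i, sep (x i) (y i))

/-- relative piece of `p` w.r.t. cell `k`. -/
noncomputable def rl (k p : P) : O := by
  classical exact if p.l = k.l then none else some p

theorem rl_getD {k p : P} {σ : S} (hk : m k σ) (hp : m p σ) : (rl k p).getD k = p := by
  unfold rl
  split_ifs with e
  · simp only [mP] at hk hp
    simp only [Option.getD_none]
    ext
    · exact e.symm
    · rw [← hk, ← hp, e]
  · rfl

theorem rl_leg {k p q : P} (h : rl k p = some q) : q.l ≠ k.l := by
  unfold rl at h
  split_ifs at h with e
  simp only [Option.some.injEq] at h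
  subst h; exact e

theorem rl_self (k : P) : rl k k = none := by simp [rl]

theorem m_rl {k p : P} {σ : S} (hp : m p σ) : m (rl k p) σ := by
  unfold rl; split_ifs <;> simp_all

/-- point moved into the cell. -/
noncomputable def mv (k : P) (σ : S) : S := by
  classical exact fun l => if l = k.l then k.a else σ l

theorem m_mv (k : P) (σ : S) : m k (mv k σ) := by simp [mv]

theorem m_rl_mv {k p : P} {σ : S} (hp : m p (mv k σ)) : m (rl k p) σ := by
  unfold rl
  split_ifs with e
  · simp
  · simpa [mv, e] using hp

theorem mv_of_m {k : P} {σ : S} (h : m k σ) : mv k σ = σ := by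
  funext l
  unfold mv
  simp only [mP] at h
  split_ifs with e
  · rw [e, h]
  · rfl

theorem sep_getD {k : P} {u v : O} (hu : ∀ p, u = some p → p.l ≠ k.l)
    (hv : ∀ p, v = some p → p.l ≠ k.l) (h : sep (u.getD k) (v.getD k)) : sep u v := by
  rcases u with _ | p <;> rcases v with _ | q
  · simp at h
  · simp at h; exact absurd h.1.symm (hv q rfl)
  · simp at h; exact absurd h.1 (hu p rfl)
  · simpa using h

theorem getD_inj {k : P} {u v : O} (hu : ∀ p, u = some p → p.l ≠ k.l)
    (hv : ∀ p, v = some p → p.l ≠ k.l) (h : u.getD k = v.getD k) : u = v := by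
  rcases u with _ | p <;> rcases v with _ | q
  · rfl
  · simp at h; exact absurd (by rw [h]) (hv q rfl)
  · simp at h; exact absurd (by rw [h]) (hu p rfl)
  · simpa using h

theorem LocTil.rel {n : ℕ} {F : (Fin n → P) → Prop} {K : Fin n → P} (h : LocTil F K) :
    TilF (Rel F K) := by
  refine ⟨fun σ => ?_, fun u v hu hv => ?_⟩
  · obtain ⟨x, hx, hm⟩ := h.1 (fun i => mv (K i) (σ i)) (fun i => m_mv _ _)
    refine ⟨fun i => rl (K i) (x i), ⟨?_, fun i p hp => rl_leg hp⟩, fun i => m_rl_mv (hm i)⟩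
    convert hx using 1
    funext i
    exact rl_getD (m_mv _ _) (hm i)
  · rcases h.2 _ _ hu.1 hv.1 with e | ⟨i, hi⟩
    · left; funext i
      exact getD_inj (hu.2 i) (hv.2 i) (congrFun e i)
    · exact Or.inr ⟨i, sep_getD (hu.2 i) (hv.2 i) hi⟩

theorem NoColF.rel {n : ℕ} {F : (Fin n → P) → Prop} (K : Fin n → P) (h : NoColF F) :
    NoColF (Rel F K) := by
  intro u i l
  obtain ⟨a, ha⟩ := h (fun i => (u i).getD (K i)) i l
  refine ⟨a, fun hc => ha ?_⟩
  convert hc.1 using 1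
  funext j
  by_cases e : j = i
  · subst e; simp
  · simp [Function.update_of_ne e]

theorem fact1core {n : ℕ} {T : (Fin (n+2) → P) → Prop} (h : TilF T) (hn : NoColF T)
    (σ0 : S) (r : ℤ → P) (l : ℝ) (K : Fin n → P)
    (hr : ∀ a, m (r a) σ0) (hT : ∀ a, T (Fin.cons (r a) (Fin.cons ⟨l, a⟩ K))) :
    ∃ B2 B1 : P, ¬ T (Fin.cons B2 (Fin.cons B1 K)) ∧
      LocTil (fun x => T (Fin.cons B2 (Fin.cons B1 x))) K := by
  classical
  obtain ⟨b, hb⟩ : ∃ b, r b ≠ r 0 := by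
    by_contra hc
    push Not at hc
    obtain ⟨a, ha⟩ := hn (Fin.cons (r 0) (Fin.cons ⟨l, 0⟩ K)) 1 l
    apply ha
    have := hT a
    rw [hc a] at this
    convert this using 1
    funext j
    refine Fin.cases ?_ (fun j => ?_) j
    · simp
    · refine Fin.cases ?_ (fun j => ?_) j
      · simp
      · rw [Function.update_of_ne]
        · simp
        · intro e; simp [Fin.ext_iff] at e
  have hlab : (r b).l ≠ (r 0).l := by
    intro e
    apply hb
    have h1 := hr b; have h2 := hr 0
    simp only [mP] at h1 h2
    ext
    · exact e
    · rw [← h1, ← h2, e]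
  obtain ⟨q, hq⟩ := hn (Fin.cons (r 0) (Fin.cons ⟨l, 0⟩ K)) 0 (r 0).l
  have hq' : ¬ T (Fin.cons ⟨(r 0).l, q⟩ (Fin.cons ⟨l, 0⟩ K)) := by
    convert hq using 2
    simp
  refine ⟨⟨(r 0).l, q⟩, ⟨l, 0⟩, hq', ⟨fun σ hσ => ?_, fun x y hx hy => ?_⟩⟩
  · have hqne : q ≠ (r 0).a := by
      intro e
      apply hq'; rw [e]; exact hT 0
    let s0 : S := fun t => if t = (r 0).l then q else (r b).a
    obtain ⟨z, hz, hm⟩ := h.1 (Fin.cons s0 (Fin.cons (fun _ => 0) σ))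
    have m0 : m (z 0) s0 := by simpa using hm 0
    have m1 : m (z 1) (fun _ => 0) := hm 1
    have m2 : ∀ j : Fin n, m (z j.succ.succ) (σ j) := fun j => by simpa using hm j.succ.succ
    have e0 : z 0 = ⟨(r 0).l, q⟩ := by
      rcases h.2 _ _ hz (hT 0) with e | ⟨i, hi⟩
      · exfalso
        have := congrFun e 0
        simp only [Fin.cons_zero] at this
        rw [this] at m0
        simp [s0] at m0
        exact hqne m0
      · revert hi
        refine Fin.cases (fun hi => ?_) (fun i => Fin.cases (fun hi => ?_) (fun i hi => ?_) i) i
        · have := (sep_someP hi m0).1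
          simpa [s0] using this
        · exfalso
          exact notsepP (σ := fun _ => 0) m1 (by simp) hi
        · exfalso
          exact notsepP (m2 i) (by simpa using hσ i) hi
    have e1 : z 1 = ⟨l, 0⟩ := by
      rcases h.2 _ _ hz (hT b) with e | ⟨i, hi⟩
      · exfalso
        have := congrFun e 0
        simp only [Fin.cons_zero] at this
        rw [e0] at this
        exact hlab (by rw [← this])
      · revert hi
        refine Fin.cases (fun hi => ?_) (fun i => Fin.cases (fun hi => ?_) (fun i hi => ?_) i) i
        · exfalso
          refine notsepP m0 ?_ hi
          simp [s0, hlab]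
        · have := (sep_someP hi m1).1
          simpa using this
        · exfalso
          exact notsepP (m2 i) (by simpa using hσ i) hi
    refine ⟨fun j => z j.succ.succ, ?_, m2⟩
    convert hz using 1
    funext j
    refine Fin.cases ?_ (fun j => ?_) j
    · simp [e0]
    · refine Fin.cases ?_ (fun j => ?_) j
      · simp [e1]
      · simp
  · rcases h.2 _ _ hx hy with e | ⟨i, hi⟩
    · left; funext j
      have := congrFun e j.succ.succ
      simpa using this
    · right
      revert hi
      refine Fin.cases (fun hi => ?_) (fun i => Fin.cases (fun hi => ?_) (fun i hi => ?_) i) i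
      · simp at hi
      · simp at hi
      · exact ⟨i, by simpa using hi⟩

theorem NoColF.tail2 {n : ℕ} {T : (Fin (n+2) → P) → Prop} (h : NoColF T) (B2 B1 : P) :
    NoColF (fun x : Fin n → P => T (Fin.cons B2 (Fin.cons B1 x))) := by
  intro x i l
  obtain ⟨a, ha⟩ := h (Fin.cons B2 (Fin.cons B1 x)) i.succ.succ l
  refine ⟨a, fun hc => ha ?_⟩
  convert hc using 1
  rw [Fin.cons_update, Fin.cons_update]

theorem fact1 {n : ℕ} {T : (Fin (n+2) → P) → Prop} (h : TilF T) (hn : NoColF T)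
    (hP : ∀ T' : (Fin (n+1) → P) → Prop, TilF T' → ¬ NoColF T') :
    ∃ (T' : (Fin (n+2) → P) → Prop) (B2 B1 : P) (K : Fin n → P), TilF T' ∧ NoColF T' ∧
      ¬ T' (Fin.cons B2 (Fin.cons B1 K)) ∧
      LocTil (fun x => T' (Fin.cons B2 (Fin.cons B1 x))) K := by
  have hsl := hP (fun y => ∃ r : P, m r (fun _ => 0) ∧ T (Fin.cons r y)) (by
    refine ⟨fun σ => ?_, ?_⟩
    · obtain ⟨z, hz, hm⟩ := h.1 (Fin.cons (fun _ => 0) σ)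
      refine ⟨fun i => z i.succ, ⟨z 0, hm 0, ?_⟩, fun i => by simpa using hm i.succ⟩
      convert hz using 1
      exact Fin.cons_self_tail z
    · rintro x y ⟨r, hr, hx⟩ ⟨s, hs, hy⟩
      rcases h.2 _ _ hx hy with e | ⟨i, hi⟩
      · left; funext j
        simpa using congrFun e j.succ
      · right; revert hi
        refine Fin.cases (fun hi => ?_) (fun i hi => ?_) i
        · exact absurd hi (notsepP (σ := fun _ => 0) hr hs)
        · exact ⟨i, by simpa using hi⟩)
  unfold NoColF at hsl
  push Not at hsl
  obtain ⟨y, i, l, hcol⟩ := hsl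
  choose r hr hrT using hcol
  let π : Equiv.Perm (Fin (n+2)) := Equiv.swap 1 i.succ
  have hππ : ∀ j, π (π j) = j := fun j => by simp [π]
  let z : ℤ → Fin (n+2) → P := fun a j => (Fin.cons (r a) (Function.update y i ⟨l, a⟩) : Fin (n+2) → P) (π j)
  have hz : ∀ a, PermF π T (z a) := by
    intro a
    simp only [PermF, z, hππ]
    exact hrT a
  have hz0 : ∀ a, z a 0 = r a := by
    intro a
    have : π 0 = 0 := by
      apply Equiv.swap_apply_of_ne_of_ne
      · simp
      · exact (Fin.succ_ne_zero i).symm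
    simp only [z, this, Fin.cons_zero]
  have hz1 : ∀ a, z a 1 = ⟨l, a⟩ := by
    intro a
    simp [z, π]
  have hz2 : ∀ a j, z a (Fin.succ (Fin.succ j)) = z 0 (Fin.succ (Fin.succ j)) := by
    intro a j
    have hne : π j.succ.succ ≠ i.succ := by
      intro e
      have := congrArg π e
      rw [hππ] at this
      simp [π] at this
      simp [Fin.ext_iff] at this
    have hne0 : π j.succ.succ ≠ 0 := by
      intro e
      have := congrArg π e
      rw [hππ] at this
      have h0 : π 0 = 0 := by
        apply Equiv.swap_apply_of_ne_of_ne
        · simp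
        · exact (Fin.succ_ne_zero i).symm
      rw [h0] at this
      exact Fin.succ_ne_zero _ this
    simp only [z]
    revert hne hne0
    generalize π j.succ.succ = k
    refine Fin.cases ?_ (fun k => ?_) k
    · simp
    · intro h1 _
      have : k ≠ i := fun e => h1 (by rw [e])
      simp [Function.update_of_ne this]
  obtain ⟨B2, B1, h1, h2⟩ := fact1core (h.perm π) (hn.perm π) (fun _ => 0) r l
    (fun j => z 0 j.succ.succ) hr (by
      intro a
      convert hz a using 1
      funext j
      refine Fin.cases ?_ (fun j => Fin.cases ?_ (fun j => ?_) j) j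
      · simp [hz0]
      · simp [hz1]
      · simp [hz2 a])
  exact ⟨_, B2, B1, _, h.perm π, hn.perm π, h1, h2⟩

def PP (n : ℕ) : Prop := ∀ T : (Fin n → P) → Prop, TilF T → ¬ NoColF T

theorem PP_step {n : ℕ} (hP : PP (n+1)) (hL : ∀ C : (Fin n → O) → Prop, TilF C → NoColF C →
    C (fun _ => none)) : PP (n+2) := by
  intro T h hn
  obtain ⟨T', B2, B1, K, h1, h2, h3, h4⟩ := fact1 h hn hP
  have := hL _ h4.rel ((h2.tail2 B2 B1).rel K)
  exact h3 (by simpa using this.1)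

theorem cur1 {C : (Fin 1 → O) → Prop} (h : TilF C) : Til1 (fun a => C ![a]) := by
  refine ⟨fun s => ?_, fun u v hu hv => ?_⟩
  · obtain ⟨x, hx, hm⟩ := h.1 ![s]
    refine ⟨x 0, ?_, hm 0⟩
    convert hx using 1
    funext i; fin_cases i; rfl
  · rcases h.2 _ _ hu hv with e | ⟨i, hi⟩
    · exact Or.inr (congrFun e 0)
    · fin_cases i; exact Or.inl hi

theorem ncur1 {C : (Fin 1 → O) → Prop} (h : NoColF C) : NC1 (fun a => C ![a]) := by
  intro l
  obtain ⟨a, ha⟩ := h ![none] 0 l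
  refine ⟨a, fun hc => ha ?_⟩
  convert hc using 1
  funext i; fin_cases i; rfl

theorem cur2 {C : (Fin 2 → O) → Prop} (h : TilF C) : Til2 (fun a b => C ![a, b]) := by
  refine ⟨fun s1 s2 => ?_, fun u1 u2 v1 v2 hu hv => ?_⟩
  · obtain ⟨x, hx, hm⟩ := h.1 ![s1, s2]
    refine ⟨x 0, x 1, ?_, hm 0, hm 1⟩
    convert hx using 1
    funext i; fin_cases i <;> rfl
  · rcases h.2 _ _ hu hv with e | ⟨i, hi⟩
    · exact Or.inr (Or.inr ⟨congrFun e 0, congrFun e 1⟩)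
    · fin_cases i
      · exact Or.inl hi
      · exact Or.inr (Or.inl hi)

theorem ncur2 {C : (Fin 2 → O) → Prop} (h : NoColF C) : NC2 (fun a b => C ![a, b]) := by
  refine ⟨fun u l => ?_, fun u l => ?_⟩
  · obtain ⟨a, ha⟩ := h ![none, u] 0 l
    refine ⟨a, fun hc => ha ?_⟩
    convert hc using 1
    funext i; fin_cases i <;> rfl
  · obtain ⟨a, ha⟩ := h ![u, none] 1 l
    refine ⟨a, fun hc => ha ?_⟩
    convert hc using 1
    funext i; fin_cases i <;> rfl

theorem cur3 {C : (Fin 3 → O) → Prop} (h : TilF C) : Til3 (fun a b c => C ![a, b, c]) := by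
  refine ⟨fun s1 s2 s3 => ?_, fun u1 u2 u3 v1 v2 v3 hu hv => ?_⟩
  · obtain ⟨x, hx, hm⟩ := h.1 ![s1, s2, s3]
    refine ⟨x 0, x 1, x 2, ?_, hm 0, hm 1, hm 2⟩
    convert hx using 1
    funext i; fin_cases i <;> rfl
  · rcases h.2 _ _ hu hv with e | ⟨i, hi⟩
    · exact Or.inr (Or.inr (Or.inr ⟨congrFun e 0, congrFun e 1, congrFun e 2⟩))
    · fin_cases i
      · exact Or.inl hi
      · exact Or.inr (Or.inl hi)
      · exact Or.inr (Or.inr (Or.inl hi))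

theorem ncur3 {C : (Fin 3 → O) → Prop} (h : NoColF C) : NC3 (fun a b c => C ![a, b, c]) := by
  refine ⟨fun u v l => ?_, fun u v l => ?_, fun u v l => ?_⟩
  · obtain ⟨a, ha⟩ := h ![none, u, v] 0 l
    refine ⟨a, fun hc => ha ?_⟩
    convert hc using 1
    funext i; fin_cases i <;> rfl
  · obtain ⟨a, ha⟩ := h ![u, none, v] 1 l
    refine ⟨a, fun hc => ha ?_⟩
    convert hc using 1
    funext i; fin_cases i <;> rfl
  · obtain ⟨a, ha⟩ := h ![u, v, none] 2 l
    refine ⟨a, fun hc => ha ?_⟩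
    convert hc using 1
    funext i; fin_cases i <;> rfl

theorem cur4 {C : (Fin 4 → O) → Prop} (h : TilF C) : Til4 (fun a b c d => C ![a, b, c, d]) := by
  refine ⟨fun s1 s2 s3 s4 => ?_, fun u1 u2 u3 u4 v1 v2 v3 v4 hu hv => ?_⟩
  · obtain ⟨x, hx, hm⟩ := h.1 ![s1, s2, s3, s4]
    refine ⟨x 0, x 1, x 2, x 3, ?_, hm 0, hm 1, hm 2, hm 3⟩
    convert hx using 1
    funext i; fin_cases i <;> rfl
  · rcases h.2 _ _ hu hv with e | ⟨i, hi⟩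
    · exact Or.inr (Or.inr (Or.inr (Or.inr ⟨congrFun e 0, congrFun e 1, congrFun e 2, congrFun e 3⟩)))
    · fin_cases i
      · exact Or.inl hi
      · exact Or.inr (Or.inl hi)
      · exact Or.inr (Or.inr (Or.inl hi))
      · exact Or.inr (Or.inr (Or.inr (Or.inl hi)))

theorem ncur4 {C : (Fin 4 → O) → Prop} (h : NoColF C) : NC4 (fun a b c d => C ![a, b, c, d]) := by
  refine ⟨fun u v w l => ?_, fun u v w l => ?_, fun u v w l => ?_, fun u v w l => ?_⟩
  · obtain ⟨a, ha⟩ := h ![none, u, v, w] 0 l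
    refine ⟨a, fun hc => ha ?_⟩
    convert hc using 1
    funext i; fin_cases i <;> rfl
  · obtain ⟨a, ha⟩ := h ![u, none, v, w] 1 l
    refine ⟨a, fun hc => ha ?_⟩
    convert hc using 1
    funext i; fin_cases i <;> rfl
  · obtain ⟨a, ha⟩ := h ![u, v, none, w] 2 l
    refine ⟨a, fun hc => ha ?_⟩
    convert hc using 1
    funext i; fin_cases i <;> rfl
  · obtain ⟨a, ha⟩ := h ![u, v, w, none] 3 l
    refine ⟨a, fun hc => ha ?_⟩
    convert hc using 1
    funext i; fin_cases i <;> rfl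

theorem PP1 : PP 1 := by
  intro T h hn
  have : Til1 (fun u => ∃ p, u = some p ∧ T ![p]) := by
    refine ⟨fun s => ?_, ?_⟩
    · obtain ⟨x, hx, hm⟩ := h.1 ![s]
      refine ⟨some (x 0), ⟨_, rfl, ?_⟩, by simpa using hm 0⟩
      convert hx using 1
      funext i; fin_cases i; rfl
    · rintro _ _ ⟨p, rfl, hp⟩ ⟨q, rfl, hq⟩
      rcases h.2 _ _ hp hq with e | ⟨i, hi⟩
      · exact Or.inr (congrArg some (congrFun e 0))
      · fin_cases i; exact Or.inl (by simpa using hi)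
  obtain ⟨p, hp, -⟩ := L1' this (by
    intro l
    obtain ⟨a, ha⟩ := hn ![⟨l, 0⟩] 0 l
    refine ⟨a, ?_⟩
    rintro ⟨p, hp, hT⟩
    simp only [Option.some.injEq] at hp
    subst hp
    apply ha
    convert hT using 1
    funext i; fin_cases i; rfl)
  simp at hp

theorem PP2 : PP 2 := PP_step PP1 (by
  intro C h _
  obtain ⟨x, hx, -⟩ := h.1 (fun _ _ => 0)
  convert hx)

theorem PP3 : PP 3 := PP_step PP2 (by
  intro C h hn
  have := L1' (cur1 h) (ncur1 hn)
  convert this using 1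
  funext i; fin_cases i; rfl)

theorem PP4 : PP 4 := PP_step PP3 (by
  intro C h hn
  have := L2 (cur2 h) (ncur2 hn)
  convert this using 1
  funext i; fin_cases i <;> rfl)

end Kel

set_option linter.unusedVariables false
set_option linter.unusedSimpArgs false
namespace Kel
open Pce

@[simp] theorem sepO_irrefl (u : O) : sep u u ↔ False := by
  rcases u with _ | p <;> simp

theorem sep_lab {u : O} {x : ℝ} {p : ℤ} (h : sep u (some ⟨x, p⟩)) : ∃ p', u = some ⟨x, p'⟩ := by
  obtain ⟨p1, q, rfl, h2, h3, h4⟩ := h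
  simp only [Option.some.injEq] at h2
  subst h2
  exact ⟨p1.a, by congr 1; ext <;> simp [h3]⟩

theorem sep_lab' {u : O} {x : ℝ} {p : ℤ} (h : sep (some ⟨x, p⟩) u) : ∃ p', u = some ⟨x, p'⟩ :=
  sep_lab (sepO_symm h)

theorem Til3.rot {C : O → O → O → Prop} (h : Til3 C) : Til3 (fun a b c => C b c a) := by
  refine ⟨fun s1 s2 s3 => ?_, fun u1 u2 u3 v1 v2 v3 hu hv => ?_⟩
  · obtain ⟨a, b, c, h1, h2, h3, h4⟩ := h.ex s2 s3 s1
    exact ⟨c, a, b, h1, h4, h2, h3⟩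
  · have := h.sp _ _ _ _ _ _ hu hv
    tauto

theorem NC3.rot {C : O → O → O → Prop} (h : NC3 C) : NC3 (fun a b c => C b c a) :=
  ⟨fun u v l => h.c3 _ _ l, fun u v l => h.c1 _ _ l, fun u v l => h.c2 _ _ l⟩

theorem Til3.sw {C : O → O → O → Prop} (h : Til3 C) : Til3 (fun a b c => C a c b) := by
  refine ⟨fun s1 s2 s3 => ?_, fun u1 u2 u3 v1 v2 v3 hu hv => ?_⟩
  · obtain ⟨a, b, c, h1, h2, h3, h4⟩ := h.ex s1 s3 s2
    exact ⟨a, c, b, h1, h2, h4, h3⟩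
  · have := h.sp _ _ _ _ _ _ hu hv
    tauto

theorem NC3.sw {C : O → O → O → Prop} (h : NC3 C) : NC3 (fun a b c => C a c b) :=
  ⟨fun u v l => h.c1 _ _ l, fun u v l => h.c3 _ _ l, fun u v l => h.c2 _ _ l⟩

theorem Til3.line1 {C : O → O → O → Prop} (h : Til3 C) (hn : NC3 C) {y z : O}
    (H : ∀ s, ∃ u, C u y z ∧ m u s) : C none y z := by
  refine L1' (C := fun u => C u y z) ⟨H, fun u v hu hv => ?_⟩ (fun l => hn.c1 _ _ l)
  have := h.sp _ _ _ _ _ _ hu hv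
  simp at this; tauto

theorem Til3.line2 {C : O → O → O → Prop} (h : Til3 C) (hn : NC3 C) {y z : O}
    (H : ∀ s, ∃ u, C y u z ∧ m u s) : C y none z := by
  refine L1' (C := fun u => C y u z) ⟨H, fun u v hu hv => ?_⟩ (fun l => hn.c2 _ _ l)
  have := h.sp _ _ _ _ _ _ hu hv
  simp at this; tauto

theorem Til3.line3 {C : O → O → O → Prop} (h : Til3 C) (hn : NC3 C) {y z : O}
    (H : ∀ s, ∃ u, C y z u ∧ m u s) : C y z none := by
  refine L1' (C := fun u => C y z u) ⟨H, fun u v hu hv => ?_⟩ (fun l => hn.c3 _ _ l)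
  have := h.sp _ _ _ _ _ _ hu hv
  simp at this; tauto

theorem Til3.plane12 {C : O → O → O → Prop} (h : Til3 C) (hn : NC3 C) {z : O}
    (H : ∀ s t, ∃ u v, C u v z ∧ m u s ∧ m v t) : C none none z := by
  refine L2 (C := fun u v => C u v z) ⟨H, fun u v u' v' hu hv => ?_⟩
    ⟨fun u l => hn.c1 _ _ l, fun u l => hn.c2 _ _ l⟩
  have := h.sp _ _ _ _ _ _ hu hv
  simp at this; tauto

/-- a corner -/
structure Crn (C : O → O → O → Prop) (a b c : ℝ) (t1 t2 t3 : ℤ → Prop) : Prop where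
  n1 : ∃ p, t1 p
  n1' : ∃ p, ¬ t1 p
  n2 : ∃ p, t2 p
  n2' : ∃ p, ¬ t2 p
  n3 : ∃ p, t3 p
  n3' : ∃ p, ¬ t3 p
  b1 : ∀ p q r, t1 p → t2 q → t3 r → C (some ⟨a, p⟩) (some ⟨b, q⟩) (some ⟨c, r⟩)
  b0 : ∀ p q r, ¬ t1 p → ¬ t2 q → ¬ t3 r → C (some ⟨a, p⟩) (some ⟨b, q⟩) (some ⟨c, r⟩)
  r3 : ∀ p q, t1 p → ¬ t2 q → C (some ⟨a, p⟩) (some ⟨b, q⟩) none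
  r1 : ∀ q r, t2 q → ¬ t3 r → C none (some ⟨b, q⟩) (some ⟨c, r⟩)
  r2 : ∀ p r, t3 r → ¬ t1 p → C (some ⟨a, p⟩) none (some ⟨c, r⟩)

def Corner (C : O → O → O → Prop) : Prop :=
  ∃ a b c t1 t2 t3, Crn C a b c t1 t2 t3

theorem Crn.rot {C : O → O → O → Prop} {a b c t1 t2 t3} (h : Crn C a b c t1 t2 t3) :
    Crn (fun x y z => C y z x) c a b t3 t1 t2 :=
  ⟨h.n3, h.n3', h.n1, h.n1', h.n2, h.n2', fun p q r h1 h2 h3 => h.b1 _ _ _ h2 h3 h1,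
    fun p q r h1 h2 h3 => h.b0 _ _ _ h2 h3 h1, fun p q h1 h2 => h.r2 _ _ h1 h2,
    fun p q h1 h2 => h.r3 _ _ h1 h2, fun p q h1 h2 => h.r1 _ _ h1 h2⟩

theorem Corner.rot {C : O → O → O → Prop} (h : Corner C) : Corner (fun x y z => C y z x) := by
  obtain ⟨a, b, c, t1, t2, t3, h⟩ := h
  exact ⟨_, _, _, _, _, _, h.rot⟩

theorem L3a {C : O → O → O → Prop} (h : Til3 C) (hn : NC3 C) {b c : ℝ} {q0 r0 q : ℤ}
    (w : C none (some ⟨b, q0⟩) (some ⟨c, r0⟩)) (hq : ¬ C none (some ⟨b, q⟩) (some ⟨c, r0⟩)) :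
    ∃ u v, C u (some ⟨b, q⟩) v ∧ ∀ r, v ≠ some ⟨c, r⟩ := by
  by_contra hc
  push Not at hc
  apply hq
  have hne : q ≠ q0 := by rintro rfl; exact hq w
  apply h.line1 hn
  intro s
  obtain ⟨x1, x2, x3, hx, m1, m2, m3⟩ := h.ex s (fun _ => q) (fun _ => r0)
  have e2 : x2 = some ⟨b, q⟩ := by
    rcases h.sp _ _ _ _ _ _ hx w with a | a | a | ⟨-, a, -⟩
    · simp at a
    · exact (sep_some a m2).1
    · exact absurd rfl (sep_some a m3).2
    · subst a; simp at m2; exact absurd m2 hne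
  subst e2
  obtain ⟨r, rfl⟩ := hc _ _ hx
  simp at m3
  subst m3
  exact ⟨_, hx, m1⟩

theorem L3b {C : O → O → O → Prop} (h : Til3 C) (hn : NC3 C) {a b c : ℝ} {q0 r0 q r1 p' : ℤ}
    {v' : O} (w : C none (some ⟨b, q0⟩) (some ⟨c, r0⟩)) (hq : q ≠ q0)
    (hM : C (some ⟨a, p'⟩) v' (some ⟨c, r1⟩)) (hv' : ∀ t, v' ≠ some ⟨b, t⟩)
    {u v : O} (hu : C u (some ⟨b, q⟩) v) (hv : ∀ t, v ≠ some ⟨c, t⟩) :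
    ∃ p, u = some ⟨a, p⟩ ∧ C (some ⟨a, p⟩) (some ⟨b, q⟩) none := by
  have key : ∀ u v, C u (some ⟨b, q⟩) v → (∀ t, v ≠ some ⟨c, t⟩) → ∃ p, u = some ⟨a, p⟩ := by
    intro u v hu hv
    rcases h.sp _ _ _ _ _ _ hu hM with e | e | e | ⟨e, -, -⟩
    · exact sep_lab e
    · obtain ⟨t, ht⟩ := sep_lab' e
      exact absurd ht (hv' t)
    · obtain ⟨t, ht⟩ := sep_lab e
      exact absurd ht (hv t)
    · exact ⟨p', e⟩
  obtain ⟨p, rfl⟩ := key u v hu hv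
  refine ⟨p, rfl, ?_⟩
  apply h.line3 hn
  intro s
  obtain ⟨x1, x2, x3, hx, m1, m2, m3⟩ := h.ex (fun _ => p) (fun _ => q) s
  have e3 : ∀ t, x3 ≠ some ⟨c, t⟩ := by
    rintro t rfl
    rcases h.sp _ _ _ _ _ _ hx hu with e | e | e | ⟨-, -, e⟩
    · exact absurd rfl (sep_some e m1).2
    · exact absurd rfl (sep_some e m2).2
    · obtain ⟨t, ht⟩ := sep_lab' e
      exact absurd ht (hv t)
    · exact hv t e.symm
  have e2 : x2 = some ⟨b, q⟩ := by
    rcases h.sp _ _ _ _ _ _ hx w with e | e | e | ⟨-, e, e'⟩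
    · simp at e
    · exact (sep_some e m2).1
    · obtain ⟨t, ht⟩ := sep_lab e
      exact absurd ht (e3 t)
    · exact absurd e' (e3 _)
  subst e2
  obtain ⟨p2, rfl⟩ := key _ _ hx e3
  simp at m1
  subst m1
  exact ⟨_, hx, m3⟩

/-- Q-side filling. -/
theorem L3c {C : O → O → O → Prop} (h : Til3 C) {a b c : ℝ} {q0 r p q pN : ℤ}
    (w : C none (some ⟨b, q0⟩) (some ⟨c, r⟩)) (hq : q ≠ q0)
    (hN : C (some ⟨a, pN⟩) (some ⟨b, q⟩) none)
    (key : ∀ u v, C u (some ⟨b, q⟩) v → (∀ t, v ≠ some ⟨c, t⟩) →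
      ∃ p, u = some ⟨a, p⟩ ∧ C (some ⟨a, p⟩) (some ⟨b, q⟩) none)
    (hp : ¬ C (some ⟨a, p⟩) (some ⟨b, q⟩) none) :
    C (some ⟨a, p⟩) (some ⟨b, q⟩) (some ⟨c, r⟩) := by
  obtain ⟨x1, x2, x3, hx, m1, m2, m3⟩ := h.ex (fun _ => p) (fun _ => q) (fun _ => r)
  have e2 : x2 = some ⟨b, q⟩ := by
    rcases h.sp _ _ _ _ _ _ hx w with e | e | e | ⟨-, e, e'⟩
    · simp at e
    · exact (sep_some e m2).1
    · exact absurd rfl (sep_some e m3).2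
    · subst e; simp at m2; exact absurd m2 hq
  subst e2
  have e3 : x3 = some ⟨c, r⟩ := by
    by_cases hc : ∀ t, x3 ≠ some ⟨c, t⟩
    · obtain ⟨p2, rfl, h2⟩ := key _ _ hx hc
      simp at m1; subst m1; exact absurd h2 hp
    · push Not at hc
      obtain ⟨t, rfl⟩ := hc
      simp at m3; subst m3; rfl
  subst e3
  rcases h.sp _ _ _ _ _ _ hx hN with e | e | e | ⟨e, e', e''⟩
  · have := (sep_some e m1).1; rw [this] at hx; exact hx
  · simp at e
  · simp at e
  · simp at e''

theorem L3d {C : O → O → O → Prop} (h : Til3 C) {a b c : ℝ} {q0 r0 r p q pN : ℤ}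
    (w : C none (some ⟨b, q0⟩) (some ⟨c, r0⟩)) (hq : q ≠ q0) 
    (hN : C (some ⟨a, pN⟩) (some ⟨b, q⟩) none)
    (key : ∀ u v, C u (some ⟨b, q⟩) v → (∀ t, v ≠ some ⟨c, t⟩) →
      ∃ p, u = some ⟨a, p⟩ ∧ C (some ⟨a, p⟩) (some ⟨b, q⟩) none)
    (key' : ∀ u v, C u v (some ⟨c, r⟩) → (∀ t, v ≠ some ⟨b, t⟩) →
      ∃ p, u = some ⟨a, p⟩ ∧ C (some ⟨a, p⟩) none (some ⟨c, r⟩))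
    (hp : ¬ C (some ⟨a, p⟩) (some ⟨b, q⟩) none)
    (hp' : ¬ C (some ⟨a, p⟩) none (some ⟨c, r⟩)) :
    C (some ⟨a, p⟩) (some ⟨b, q⟩) (some ⟨c, r⟩) := by
  obtain ⟨x1, x2, x3, hx, m1, m2, m3⟩ := h.ex (fun _ => p) (fun _ => q) (fun _ => r)
  have e23 : x2 = some ⟨b, q⟩ ∧ x3 = some ⟨c, r⟩ := by
    have : x2 = some ⟨b, q⟩ ∨ x3 = some ⟨c, r⟩ := by
      rcases h.sp _ _ _ _ _ _ hx w with e | e | e | ⟨-, e, e'⟩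
      · simp at e
      · exact Or.inl (sep_some e m2).1
      · exact Or.inr (sep_some e m3).1
      · subst e; simp at m2; exact absurd m2 hq
    rcases this with rfl | rfl
    · refine ⟨rfl, ?_⟩
      by_cases hc : ∀ t, x3 ≠ some ⟨c, t⟩
      · obtain ⟨p2, rfl, h2⟩ := key _ _ hx hc
        simp at m1; subst m1; exact absurd h2 hp
      · push Not at hc
        obtain ⟨t, rfl⟩ := hc
        simp at m3; subst m3; rfl
    · refine ⟨?_, rfl⟩
      by_cases hc : ∀ t, x2 ≠ some ⟨b, t⟩
      · obtain ⟨p2, rfl, h2⟩ := key' _ _ hx hc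
        simp at m1; subst m1; exact absurd h2 hp'
      · push Not at hc
        obtain ⟨t, rfl⟩ := hc
        simp at m2; subst m2; rfl
  obtain ⟨rfl, rfl⟩ := e23
  rcases h.sp _ _ _ _ _ _ hx hN with e | e | e | ⟨e, e', e''⟩
  · have := (sep_some e m1).1; rw [this] at hx; exact hx
  · simp at e
  · simp at e
  · simp at e''

theorem L3core {C : O → O → O → Prop} (h : Til3 C) (hn : NC3 C) {b c : ℝ} {q0 r0 : ℤ}
    (w : C none (some ⟨b, q0⟩) (some ⟨c, r0⟩)) : Corner C := by
  obtain ⟨q1, hq1⟩ := hn.c2 none (some ⟨c, r0⟩) b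
  obtain ⟨r1, hr1⟩ := hn.c3 none (some ⟨b, q0⟩) c
  obtain ⟨u1, v1, hu1, hv1⟩ := L3a h hn w hq1
  obtain ⟨u2, v2, hu2, hv2⟩ := L3a h.sw hn.sw (C := fun a b c => C a c b) w hr1
  have hqne : ∀ q, ¬ C none (some ⟨b, q⟩) (some ⟨c, r0⟩) → q ≠ q0 := by
    rintro q hq rfl; exact hq w
  have hrne : ∀ r, ¬ C none (some ⟨b, q0⟩) (some ⟨c, r⟩) → r ≠ r0 := by
    rintro q hq rfl; exact hq w
  obtain ⟨a, p1, p2, rfl, rfl⟩ : ∃ a p1 p2, u1 = some ⟨a, p1⟩ ∧ u2 = some ⟨a, p2⟩ := by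
    rcases h.sp _ _ _ _ _ _ hu1 hu2 with e | e | e | ⟨-, -, e⟩
    · obtain ⟨p, q, rfl, rfl, e1, e2⟩ := e
      exact ⟨p.l, p.a, q.a, rfl, by rw [e1]⟩
    · obtain ⟨t, ht⟩ := sep_lab' e
      exact absurd ht (hv2 t)
    · obtain ⟨t, ht⟩ := sep_lab e
      exact absurd ht (hv1 t)
    · exact absurd e (hv1 _)
  have keyQ : ∀ q, ¬ C none (some ⟨b, q⟩) (some ⟨c, r0⟩) → ∀ u v, C u (some ⟨b, q⟩) v →
      (∀ t, v ≠ some ⟨c, t⟩) → ∃ p, u = some ⟨a, p⟩ ∧ C (some ⟨a, p⟩) (some ⟨b, q⟩) none :=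
    fun q hq u v hu hv => L3b h hn w (hqne q hq) hu2 hv2 hu hv
  have keyR : ∀ r, ¬ C none (some ⟨b, q0⟩) (some ⟨c, r⟩) → ∀ u v, C u v (some ⟨c, r⟩) →
      (∀ t, v ≠ some ⟨b, t⟩) → ∃ p, u = some ⟨a, p⟩ ∧ C (some ⟨a, p⟩) none (some ⟨c, r⟩) :=
    fun r hr u v hu hv => L3b h.sw hn.sw (C := fun a b c => C a c b) w (hrne r hr) hu1 hv1 hu hv
  have exQ : ∀ q, ¬ C none (some ⟨b, q⟩) (some ⟨c, r0⟩) →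
      ∃ p, C (some ⟨a, p⟩) (some ⟨b, q⟩) none := by
    intro q hq
    obtain ⟨u, v, hu, hv⟩ := L3a h hn w hq
    obtain ⟨p, -, hp⟩ := keyQ q hq u v hu hv
    exact ⟨p, hp⟩
  have exR : ∀ r, ¬ C none (some ⟨b, q0⟩) (some ⟨c, r⟩) →
      ∃ p, C (some ⟨a, p⟩) none (some ⟨c, r⟩) := by
    intro r hr
    obtain ⟨u, v, hu, hv⟩ := L3a h.sw hn.sw (C := fun a b c => C a c b) w hr
    obtain ⟨p, -, hp⟩ := keyR r hr u v hu hv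
    exact ⟨p, hp⟩
  have disj : ∀ p q r, C (some ⟨a, p⟩) (some ⟨b, q⟩) none → C (some ⟨a, p⟩) none (some ⟨c, r⟩) →
      False := by
    intro p q r h1 h2
    have := h.sp _ _ _ _ _ _ h1 h2
    simp at this
  have fill1 : ∀ p q r, ¬ C none (some ⟨b, q⟩) (some ⟨c, r0⟩) →
      C none (some ⟨b, q0⟩) (some ⟨c, r⟩) → ¬ C (some ⟨a, p⟩) (some ⟨b, q⟩) none →
      C (some ⟨a, p⟩) (some ⟨b, q⟩) (some ⟨c, r⟩) := by
    intro p q r hq hr hp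
    obtain ⟨pN, hN⟩ := exQ q hq
    exact L3c h hr (hqne q hq) hN (keyQ q hq) hp
  have fill2 : ∀ p q r, ¬ C none (some ⟨b, q0⟩) (some ⟨c, r⟩) →
      C none (some ⟨b, q⟩) (some ⟨c, r0⟩) → ¬ C (some ⟨a, p⟩) none (some ⟨c, r⟩) →
      C (some ⟨a, p⟩) (some ⟨b, q⟩) (some ⟨c, r⟩) := by
    intro p q r hr hq hp
    obtain ⟨pN, hN⟩ := exR r hr
    exact L3c h.sw (C := fun a b c => C a c b) hq (hrne r hr) hN (keyR r hr) hp
  have fill3 : ∀ p q r, ¬ C none (some ⟨b, q⟩) (some ⟨c, r0⟩) →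
      ¬ C none (some ⟨b, q0⟩) (some ⟨c, r⟩) → ¬ C (some ⟨a, p⟩) (some ⟨b, q⟩) none →
      ¬ C (some ⟨a, p⟩) none (some ⟨c, r⟩) →
      C (some ⟨a, p⟩) (some ⟨b, q⟩) (some ⟨c, r⟩) := by
    intro p q r hq hr hp hp'
    obtain ⟨pN, hN⟩ := exQ q hq
    exact L3d h w (hqne q hq) hN (keyQ q hq) (keyR r hr) hp hp'
  have covR : ∀ r p, ¬ C none (some ⟨b, q0⟩) (some ⟨c, r⟩) → ¬ C (some ⟨a, p⟩) none (some ⟨c, r⟩) →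
      ∃ q, ¬ C none (some ⟨b, q⟩) (some ⟨c, r0⟩) ∧ C (some ⟨a, p⟩) (some ⟨b, q⟩) none := by
    intro r p hr hp
    by_contra hc
    push Not at hc
    obtain ⟨q, hq⟩ := hn.c2 (some ⟨a, p⟩) (some ⟨c, r⟩) b
    apply hq
    by_cases hQ : C none (some ⟨b, q⟩) (some ⟨c, r0⟩)
    · exact fill2 p q r hr hQ hp
    · exact fill3 p q r hQ hr (hc q hQ) hp
  have covQ : ∀ q p, ¬ C none (some ⟨b, q⟩) (some ⟨c, r0⟩) → ¬ C (some ⟨a, p⟩) (some ⟨b, q⟩) none →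
      ∃ r, ¬ C none (some ⟨b, q0⟩) (some ⟨c, r⟩) ∧ C (some ⟨a, p⟩) none (some ⟨c, r⟩) := by
    intro q p hq hp
    by_contra hc
    push Not at hc
    obtain ⟨r, hr⟩ := hn.c3 (some ⟨a, p⟩) (some ⟨b, q⟩) c
    apply hr
    by_cases hR : C none (some ⟨b, q0⟩) (some ⟨c, r⟩)
    · exact fill1 p q r hq hR hp
    · exact fill3 p q r hq hR hp (hc r hR)
  refine ⟨a, b, c,
    fun p => ∃ q, ¬ C none (some ⟨b, q⟩) (some ⟨c, r0⟩) ∧ C (some ⟨a, p⟩) (some ⟨b, q⟩) none,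
    fun q => C none (some ⟨b, q⟩) (some ⟨c, r0⟩), fun r => ¬ C none (some ⟨b, q0⟩) (some ⟨c, r⟩),
    ?_, ?_, ⟨q0, w⟩, ⟨q1, hq1⟩, ⟨r1, hr1⟩, ⟨r0, by simpa using w⟩, ?_, ?_, ?_, ?_, ?_⟩
  · obtain ⟨p, hp⟩ := exQ q1 hq1
    exact ⟨p, q1, hq1, hp⟩
  · obtain ⟨p, hp⟩ := exR r1 hr1
    refine ⟨p, ?_⟩
    rintro ⟨q, -, hq⟩
    exact disj _ _ _ hq hp
  · rintro p q r ⟨q', hq', hp⟩ hq hr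
    exact fill2 p q r hr hq (fun hc => disj _ _ _ hp hc)
  · intro p q r hp hq hr
    push Not at hp hr
    exact fill1 p q r hq hr (hp q hq)
  · rintro p q ⟨q', hq', hp⟩ hq
    by_contra hc
    obtain ⟨r, -, hr⟩ := covQ q p hq hc
    exact disj _ _ _ hp hr
  · intro q r hq hr
    simp only [not_not] at hr
    by_cases eq : q = q0
    · rw [eq]; exact hr
    by_cases er : r = r0
    · rw [er]; exact hq
    apply h.line1 hn
    intro s
    obtain ⟨x1, x2, x3, hx, m1, m2, m3⟩ := h.ex s (fun _ => q) (fun _ => r)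
    have e2 : x2 = some ⟨b, q⟩ := by
      rcases h.sp _ _ _ _ _ _ hx hr with e | e | e | ⟨-, e, e'⟩
      · simp at e
      · exact (sep_some e m2).1
      · exact absurd rfl (sep_some e m3).2
      · subst e; simp at m2; exact absurd m2 eq
    have e3 : x3 = some ⟨c, r⟩ := by
      rcases h.sp _ _ _ _ _ _ hx hq with e | e | e | ⟨-, e, e'⟩
      · simp at e
      · exact absurd rfl (sep_some e m2).2
      · exact (sep_some e m3).1
      · subst e'; simp at m3; exact absurd m3 er
    subst e2 e3
    exact ⟨_, hx, m1⟩
  · intro p r hr hp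
    by_contra hc
    exact hp (covR r p hr hc)

theorem L3two {C : O → O → O → Prop} (h : Til3 C) (hn : NC3 C) {z : O}
    (w : C none none z) : C none none none := by
  rcases z with _ | ⟨c, r0⟩
  · exact w
  obtain ⟨r, hr⟩ := hn.c3 none none c
  exfalso; apply hr
  apply h.plane12 hn
  intro s t
  obtain ⟨x1, x2, x3, hx, m1, m2, m3⟩ := h.ex s t (fun _ => r)
  rcases h.sp _ _ _ _ _ _ hx w with e | e | e | ⟨e1, e2, e⟩
  · simp at e
  · simp at e
  · have := (sep_some e m3).1
    subst this
    exact ⟨_, _, hx, m1, m2⟩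
  · subst e e1 e2
    simp at m3
    subst m3
    exact absurd w hr

theorem L3one {C : O → O → O → Prop} (h : Til3 C) (hn : NC3 C) (h0 : ¬ C none none none)
    {y z : O} (w : C none y z) : Corner C := by
  rcases y with _ | ⟨b, q⟩
  · exact absurd (L3two h hn w) h0
  rcases z with _ | ⟨c, r⟩
  · exact absurd (L3two h.rot hn.rot (C := fun a b c => C b c a) w) h0
  exact L3core h hn w

theorem L3 {C : O → O → O → Prop} (h : Til3 C) (hn : NC3 C) (h0 : ¬ C none none none) :
    Corner C := by
  by_cases w1 : ∃ y z, C none y z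
  · obtain ⟨y, z, w⟩ := w1
    exact L3one h hn h0 w
  by_cases w2 : ∃ y z, C y none z
  · obtain ⟨y, z, w⟩ := w2
    exact (L3one h.rot.rot hn.rot.rot (C := fun a b c => C c a b) h0 w).rot
  by_cases w3 : ∃ y z, C y z none
  · obtain ⟨y, z, w⟩ := w3
    exact (L3one h.rot hn.rot (C := fun a b c => C b c a) h0 w).rot.rot
  exfalso
  push Not at w1 w2 w3
  refine PP3 (fun x => C (some (x 0)) (some (x 1)) (some (x 2))) ⟨fun σ => ?_, fun x y hx hy => ?_⟩ ?_
  · obtain ⟨u1, u2, u3, hu, m1, m2, m3⟩ := h.ex (σ 0) (σ 1) (σ 2)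
    rcases u1 with _ | u1
    · exact absurd hu (w1 _ _)
    rcases u2 with _ | u2
    · exact absurd hu (w2 _ _)
    rcases u3 with _ | u3
    · exact absurd hu (w3 _ _)
    refine ⟨![u1, u2, u3], hu, fun i => ?_⟩
    fin_cases i
    · simpa using m1
    · simpa using m2
    · simpa using m3
  · rcases h.sp _ _ _ _ _ _ hx hy with e | e | e | ⟨e1, e2, e3⟩
    · exact Or.inr ⟨0, by simpa using e⟩
    · exact Or.inr ⟨1, by simpa using e⟩
    · exact Or.inr ⟨2, by simpa using e⟩
    · left; funext i
      simp only [Option.some.injEq] at e1 e2 e3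
      fin_cases i
      · exact e1
      · exact e2
      · exact e3
  · intro x i l
    fin_cases i
    · obtain ⟨a, ha⟩ := hn.c1 (some (x 1)) (some (x 2)) l
      exact ⟨a, by simpa using ha⟩
    · obtain ⟨a, ha⟩ := hn.c2 (some (x 0)) (some (x 2)) l
      exact ⟨a, by simpa using ha⟩
    · obtain ⟨a, ha⟩ := hn.c3 (some (x 0)) (some (x 1)) l
      exact ⟨a, by simpa using ha⟩

end Kel

set_option linter.unusedVariables false
set_option linter.unusedSimpArgs false
namespace Kel
open Pce

theorem rod {W Λ : Type} (mW : W → Λ → Prop) (T : W → P → P → P → Prop)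
    (ex : ∀ lam s1 s2 s3, ∃ w a b c, T w a b c ∧ mW w lam ∧ m a s1 ∧ m b s2 ∧ m c s3)
    (sp : ∀ w a b c w' a' b' c', T w a b c → T w' a' b' c' → ∀ lam, mW w lam → mW w' lam →
      sep a a' ∨ sep b b' ∨ sep c c' ∨ (w = w' ∧ a = a' ∧ b = b' ∧ c = c'))
    (nc1 : ∀ w b c l, ∃ p, ¬ T w ⟨l, p⟩ b c) (nc2 : ∀ w b c l, ∃ p, ¬ T w b ⟨l, p⟩ c)
    (nc3 : ∀ w b c l, ∃ p, ¬ T w b c ⟨l, p⟩)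
    {w : W} {k B1 B2 : P} (hw : T w k B1 B2) {lam : Λ} (hl : mW w lam)
    (H : ∀ b, mW b lam → (∀ c e, T c e B1 B2 → e.l ≠ k.l → ¬ ∃ μ, mW b μ ∧ mW c μ) → b = w) :
    False := by
  obtain ⟨p, hp⟩ := nc1 w B1 B2 k.l
  have hpne : p ≠ k.a := by rintro rfl; exact hp hw
  apply hp
  have := L2 (C := fun u v => T w ⟨k.l, p⟩ (u.getD B1) (v.getD B2) ∧
      (∀ p, u = some p → p.l ≠ B1.l) ∧ (∀ p, v = some p → p.l ≠ B2.l)) ⟨fun s1 s2 => ?_, ?_⟩ ?_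
  · simpa using this.1
  · obtain ⟨b, e, y1, y2, hT, mb, me, m1, m2⟩ := ex lam (fun _ => p) (mv B1 s1) (mv B2 s2)
    have ee : e = ⟨k.l, p⟩ := by
      rcases sp _ _ _ _ _ _ _ _ hT hw lam mb hl with h | h | h | ⟨-, h, -⟩
      · exact (sep_someP h me).1
      · exact absurd h (notsepP m1 (m_mv _ _))
      · exact absurd h (notsepP m2 (m_mv _ _))
      · subst h; simp at me; exact absurd me hpne
    subst ee
    have eb : b = w := by
      refine H b mb ?_
      rintro c e hc he ⟨μ, hb, hc'⟩
      rcases sp _ _ _ _ _ _ _ _ hT hc μ hb hc' with h | h | h | ⟨-, h, -⟩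
      · exact he h.1.symm
      · exact absurd h (notsepP m1 (m_mv _ _))
      · exact absurd h (notsepP m2 (m_mv _ _))
      · exact he (by rw [← h])
    subst eb
    refine ⟨rl B1 y1, rl B2 y2, ⟨?_, fun p hp => rl_leg hp, fun p hp => rl_leg hp⟩, m_rl_mv m1, m_rl_mv m2⟩
    rw [rl_getD (m_mv _ _) m1, rl_getD (m_mv _ _) m2]
    exact hT
  · rintro u1 u2 v1 v2 ⟨h1, h2, h3⟩ ⟨h4, h5, h6⟩
    rcases sp _ _ _ _ _ _ _ _ h1 h4 lam hl hl with h | h | h | ⟨-, -, h, h'⟩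
    · simp at h
    · exact Or.inl (sep_getD h2 h5 h)
    · exact Or.inr (Or.inl (sep_getD h3 h6 h))
    · exact Or.inr (Or.inr ⟨getD_inj h2 h5 h, getD_inj h3 h6 h'⟩)
  · refine ⟨fun u l => ?_, fun u l => ?_⟩
    · obtain ⟨a, ha⟩ := nc2 w ⟨k.l, p⟩ (u.getD B2) l
      exact ⟨a, fun hc => ha hc.1⟩
    · obtain ⟨a, ha⟩ := nc3 w ⟨k.l, p⟩ (u.getD B1) l
      exact ⟨a, fun hc => ha hc.1⟩

theorem update0 {α : Type} (x0 x1 x2 x3 x4 y : α) :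
    Function.update ![x0, x1, x2, x3, x4] 0 y = ![y, x1, x2, x3, x4] := by
  funext i; fin_cases i <;> rfl
theorem update1 {α : Type} (x0 x1 x2 x3 x4 y : α) :
    Function.update ![x0, x1, x2, x3, x4] 1 y = ![x0, y, x2, x3, x4] := by
  funext i; fin_cases i <;> rfl
theorem update4 {α : Type} (x0 x1 x2 x3 x4 y : α) :
    Function.update ![x0, x1, x2, x3, x4] 4 y = ![x0, x1, x2, x3, y] := by
  funext i; fin_cases i <;> rfl
theorem PP5 : PP 5 := by
  intro T0 h0 hn0
  obtain ⟨T, B2, B1, K, h, hn, hK, hloc⟩ := fact1 h0 hn0 PP4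
  obtain ⟨a, b, c, t1, t2, t3, hc⟩ := L3 (cur3 hloc.rel) (ncur3 ((hn.tail2 B2 B1).rel K)) (by
    intro hc
    apply hK
    convert hc.1 using 3
    funext i; fin_cases i <;> rfl)
  have real : ∀ u1 u2 u3, Rel (fun x => T (Fin.cons B2 (Fin.cons B1 x))) K ![u1, u2, u3] →
      T ![B2, B1, u1.getD (K 0), u2.getD (K 1), u3.getD (K 2)] := by
    intro u1 u2 u3 hu
    convert hu.1 using 1
    funext i; fin_cases i <;> rfl
  obtain ⟨p, hp⟩ := hc.n1
  obtain ⟨p', hp'⟩ := hc.n1'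
  obtain ⟨q', hq'⟩ := hc.n2
  obtain ⟨q, hq⟩ := hc.n2'
  obtain ⟨r, hr⟩ := hc.n3
  obtain ⟨r', hr'⟩ := hc.n3'
  have b1 := hc.b1 p q' r hp hq' hr
  have b0 := hc.b0 p' q r' hp' hq hr'
  have hcl : c ≠ (K 2).l := b1.2 2 _ rfl
  have hw := real _ _ _ (hc.r3 p q hp hq)
  have b1r := real _ _ _ b1
  have b0r := real _ _ _ b0
  simp only [Option.getD_some, Option.getD_none] at hw b1r b0r
  refine rod (W := P × P) (Λ := S × S) (fun w s => m w.1 s.1 ∧ m w.2 s.2)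
    (fun w k y1 y2 => T ![y2, y1, w.1, w.2, k]) ?_ ?_ ?_ ?_ ?_ (w := (⟨a, p⟩, ⟨b, q⟩)) hw
    (lam := (fun _ => p, fun _ => q)) ⟨rfl, rfl⟩ ?_
  · intro lam s1 s2 s3
    obtain ⟨x, hx, hm⟩ := h.1 ![s3, s2, lam.1, lam.2, s1]
    refine ⟨(x 2, x 3), x 4, x 1, x 0, ?_, ⟨hm 2, hm 3⟩, hm 4, hm 1, hm 0⟩
    convert hx using 1
    funext i; fin_cases i <;> rfl
  · intro w a b c w' a' b' c' h1 h2 lam hl hl'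
    rcases h.2 _ _ h1 h2 with e | ⟨i, hi⟩
    · refine Or.inr (Or.inr (Or.inr ⟨?_, congrFun e 4, congrFun e 1, congrFun e 0⟩))
      ext1
      · exact congrFun e 2
      · exact congrFun e 3
    · fin_cases i
      · exact Or.inr (Or.inr (Or.inl hi))
      · exact Or.inr (Or.inl hi)
      · exact absurd hi (notsepP hl.1 hl'.1)
      · exact absurd hi (notsepP hl.2 hl'.2)
      · exact Or.inl hi
  · intro w b c l
    obtain ⟨a, ha⟩ := hn ![c, b, w.1, w.2, b] 4 l
    rw [update4] at ha
    exact ⟨a, ha⟩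
  · intro w b c l
    obtain ⟨a, ha⟩ := hn ![c, b, w.1, w.2, b] 1 l
    rw [update1] at ha
    exact ⟨a, ha⟩
  · intro w b c l
    obtain ⟨a, ha⟩ := hn ![c, c, w.1, w.2, b] 0 l
    rw [update0] at ha
    exact ⟨a, ha⟩
  · rintro ⟨x1, x2⟩ ⟨m1, m2⟩ hb
    have e2 : x2 = ⟨b, q⟩ := by
      by_cases hs : sep x2 ⟨b, q'⟩
      · exact (sep_someP hs m2).1
      · exfalso
        obtain ⟨σ, h1, h2⟩ := commonP hs
        exact hb (⟨a, p⟩, ⟨b, q'⟩) ⟨c, r⟩ b1r hcl ⟨(fun _ => p, σ), ⟨m1, h1⟩, rfl, h2⟩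
    have e1 : x1 = ⟨a, p⟩ := by
      by_cases hs : sep x1 ⟨a, p'⟩
      · exact (sep_someP hs m1).1
      · exfalso
        obtain ⟨σ, h1, h2⟩ := commonP hs
        exact hb (⟨a, p'⟩, ⟨b, q⟩) ⟨c, r'⟩ b0r hcl ⟨(σ, fun _ => q), ⟨h1, m2⟩, h2, rfl⟩
    rw [e1, e2]

end Kel

set_option linter.unusedVariables false
set_option linter.unusedSimpArgs false
namespace Kel
open Pce

/-- corner of a family of real boxes around the cell `k` -/
structure CAt (F : P → P → P → Prop) (k1 k2 k3 : P) (a b c : ℝ) (t1 t2 t3 : ℤ → Prop) : Prop where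
  l1 : a ≠ k1.l
  l2 : b ≠ k2.l
  l3 : c ≠ k3.l
  n1 : ∃ p, t1 p
  n1' : ∃ p, ¬ t1 p
  n2 : ∃ p, t2 p
  n2' : ∃ p, ¬ t2 p
  n3 : ∃ p, t3 p
  n3' : ∃ p, ¬ t3 p
  b1 : ∀ p q r, t1 p → t2 q → t3 r → F ⟨a, p⟩ ⟨b, q⟩ ⟨c, r⟩
  b0 : ∀ p q r, ¬ t1 p → ¬ t2 q → ¬ t3 r → F ⟨a, p⟩ ⟨b, q⟩ ⟨c, r⟩
  r3 : ∀ p q, t1 p → ¬ t2 q → F ⟨a, p⟩ ⟨b, q⟩ k3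
  r1 : ∀ q r, t2 q → ¬ t3 r → F k1 ⟨b, q⟩ ⟨c, r⟩
  r2 : ∀ p r, t3 r → ¬ t1 p → F ⟨a, p⟩ k2 ⟨c, r⟩

theorem CAt.rot {F : P → P → P → Prop} {k1 k2 k3 : P} {a b c t1 t2 t3}
    (h : CAt F k1 k2 k3 a b c t1 t2 t3) :
    CAt (fun x y z => F y z x) k3 k1 k2 c a b t3 t1 t2 :=
  ⟨h.l3, h.l1, h.l2, h.n3, h.n3', h.n1, h.n1', h.n2, h.n2', fun p q r h1 h2 h3 => h.b1 _ _ _ h2 h3 h1,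
    fun p q r h1 h2 h3 => h.b0 _ _ _ h2 h3 h1, fun p q h1 h2 => h.r2 _ _ h1 h2,
    fun p q h1 h2 => h.r3 _ _ h1 h2, fun p q h1 h2 => h.r1 _ _ h1 h2⟩

/-- curried relative family -/
def Rel3 (F : P → P → P → Prop) (k1 k2 k3 : P) (u1 u2 u3 : O) : Prop :=
  F (u1.getD k1) (u2.getD k2) (u3.getD k3) ∧ (∀ p, u1 = some p → p.l ≠ k1.l) ∧
    (∀ p, u2 = some p → p.l ≠ k2.l) ∧ (∀ p, u3 = some p → p.l ≠ k3.l)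

theorem Crn.at {F : P → P → P → Prop} {k1 k2 k3 : P} {a b c t1 t2 t3}
    (h : Crn (Rel3 F k1 k2 k3) a b c t1 t2 t3) : CAt F k1 k2 k3 a b c t1 t2 t3 := by
  obtain ⟨p, hp⟩ := h.n1
  obtain ⟨q, hq⟩ := h.n2
  obtain ⟨r, hr⟩ := h.n3
  have hb := h.b1 p q r hp hq hr
  exact ⟨hb.2.1 _ rfl, hb.2.2.1 _ rfl, hb.2.2.2 _ rfl, h.n1, h.n1', h.n2, h.n2', h.n3, h.n3',
    fun p q r h1 h2 h3 => (h.b1 _ _ _ h1 h2 h3).1, fun p q r h1 h2 h3 => (h.b0 _ _ _ h1 h2 h3).1,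
    fun p q h1 h2 => (h.r3 _ _ h1 h2).1, fun p q h1 h2 => (h.r1 _ _ h1 h2).1,
    fun p q h1 h2 => (h.r2 _ _ h1 h2).1⟩

theorem L3loc {F : P → P → P → Prop} {k1 k2 k3 : P}
    (ex : ∀ s1 s2 s3, m k1 s1 → m k2 s2 → m k3 s3 →
      ∃ x1 x2 x3, F x1 x2 x3 ∧ m x1 s1 ∧ m x2 s2 ∧ m x3 s3)
    (sp : ∀ x1 x2 x3 y1 y2 y3, F x1 x2 x3 → F y1 y2 y3 →
      sep x1 y1 ∨ sep x2 y2 ∨ sep x3 y3 ∨ (x1 = y1 ∧ x2 = y2 ∧ x3 = y3))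
    (nc1 : ∀ u v l, ∃ p, ¬ F ⟨l, p⟩ u v) (nc2 : ∀ u v l, ∃ p, ¬ F u ⟨l, p⟩ v)
    (nc3 : ∀ u v l, ∃ p, ¬ F u v ⟨l, p⟩) (h0 : ¬ F k1 k2 k3) :
    ∃ a b c t1 t2 t3, CAt F k1 k2 k3 a b c t1 t2 t3 := by
  have := L3 (C := Rel3 F k1 k2 k3) ⟨fun s1 s2 s3 => ?_, ?_⟩ ⟨?_, ?_, ?_⟩ ?_
  · obtain ⟨a, b, c, t1, t2, t3, h⟩ := this
    exact ⟨a, b, c, t1, t2, t3, h.at⟩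
  · obtain ⟨x1, x2, x3, hx, m1, m2, m3⟩ := ex (mv k1 s1) (mv k2 s2) (mv k3 s3)
      (m_mv _ _) (m_mv _ _) (m_mv _ _)
    refine ⟨rl k1 x1, rl k2 x2, rl k3 x3, ⟨?_, fun p hp => rl_leg hp, fun p hp => rl_leg hp,
      fun p hp => rl_leg hp⟩, m_rl_mv m1, m_rl_mv m2, m_rl_mv m3⟩
    rw [rl_getD (m_mv _ _) m1, rl_getD (m_mv _ _) m2, rl_getD (m_mv _ _) m3]
    exact hx
  · rintro u1 u2 u3 v1 v2 v3 ⟨hu, a1, a2, a3⟩ ⟨hv, b1, b2, b3⟩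
    rcases sp _ _ _ _ _ _ hu hv with e | e | e | ⟨e1, e2, e3⟩
    · exact Or.inl (sep_getD a1 b1 e)
    · exact Or.inr (Or.inl (sep_getD a2 b2 e))
    · exact Or.inr (Or.inr (Or.inl (sep_getD a3 b3 e)))
    · exact Or.inr (Or.inr (Or.inr ⟨getD_inj a1 b1 e1, getD_inj a2 b2 e2, getD_inj a3 b3 e3⟩))
  · intro u v l
    obtain ⟨a, ha⟩ := nc1 (u.getD k2) (v.getD k3) l
    exact ⟨a, fun hc => ha hc.1⟩
  · intro u v l
    obtain ⟨a, ha⟩ := nc2 (u.getD k1) (v.getD k3) l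
    exact ⟨a, fun hc => ha hc.1⟩
  · intro u v l
    obtain ⟨a, ha⟩ := nc3 (u.getD k1) (v.getD k2) l
    exact ⟨a, fun hc => ha hc.1⟩
  · intro hc; exact h0 hc.1

def Rigid4 (C : O → O → O → O → Prop) : Prop :=
  ∃ w1 w2 w3 s1 s2 s3, C w1 w2 w3 none ∧ m w1 s1 ∧ m w2 s2 ∧ m w3 s3 ∧
    ∀ b1 b2 b3, m b1 s1 → m b2 s2 → m b3 s3 →
      (∀ c1 c2 c3 v, C c1 c2 c3 v → v ≠ none → sep b1 c1 ∨ sep b2 c2 ∨ sep b3 c3) →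
      b1 = w1 ∧ b2 = w2 ∧ b3 = w3

def CornerL (C : O → O → O → O → Prop) : Prop := ∃ z, Corner (fun a b c => C a b c z)

def pm (π : Equiv.Perm (Fin 4)) (C : O → O → O → O → Prop) : O → O → O → O → Prop :=
  fun a b c d => C (![a, b, c, d] (π 0)) (![a, b, c, d] (π 1)) (![a, b, c, d] (π 2))
    (![a, b, c, d] (π 3))

theorem pm_pm (π ρ : Equiv.Perm (Fin 4)) (C : O → O → O → O → Prop) :
    pm π (pm ρ C) = pm (ρ.trans π) C := by
  funext a b c d
  have : ∀ i : Fin 4, (![(![a, b, c, d] : Fin 4 → O) (π 0), ![a, b, c, d] (π 1), ![a, b, c, d] (π 2),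
    ![a, b, c, d] (π 3)] : Fin 4 → O) i = ![a, b, c, d] (π i) := by
    intro i; fin_cases i <;> rfl
  simp only [pm, this, Equiv.trans_apply]

theorem Til4.pm {C : O → O → O → O → Prop} (h : Til4 C) (π : Equiv.Perm (Fin 4)) :
    Til4 (pm π C) := by
  have h' : TilF (fun x : Fin 4 → O => C (x 0) (x 1) (x 2) (x 3)) := by
    refine ⟨fun σ => ?_, fun x y hx hy => ?_⟩
    · obtain ⟨u1, u2, u3, u4, hu, m1, m2, m3, m4⟩ := h.ex (σ 0) (σ 1) (σ 2) (σ 3)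
      refine ⟨![u1, u2, u3, u4], hu, fun i => ?_⟩
      fin_cases i
      · exact m1
      · exact m2
      · exact m3
      · exact m4
    · rcases h.sp _ _ _ _ _ _ _ _ hx hy with e | e | e | e | ⟨e1, e2, e3, e4⟩
      · exact Or.inr ⟨0, e⟩
      · exact Or.inr ⟨1, e⟩
      · exact Or.inr ⟨2, e⟩
      · exact Or.inr ⟨3, e⟩
      · left; funext i; fin_cases i
        · exact e1
        · exact e2
        · exact e3
        · exact e4
  exact cur4 (h'.perm π)

theorem NC4.pm {C : O → O → O → O → Prop} (h : NC4 C) (π : Equiv.Perm (Fin 4)) :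
    NC4 (pm π C) := by
  have h' : NoColF (fun x : Fin 4 → O => C (x 0) (x 1) (x 2) (x 3)) := by
    intro x i l
    fin_cases i
    · exact h.c1 (x 1) (x 2) (x 3) l
    · exact h.c2 (x 0) (x 2) (x 3) l
    · exact h.c3 (x 0) (x 1) (x 3) l
    · exact h.c4 (x 0) (x 1) (x 2) l
  exact ncur4 (h'.perm π)

def GoodC (C : O → O → O → O → Prop) : Prop := ∃ π, CornerL (pm π C) ∨ Rigid4 (pm π C)

theorem GoodC.of_pm {C : O → O → O → O → Prop} (π : Equiv.Perm (Fin 4)) (h : GoodC (pm π C)) :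
    GoodC C := by
  obtain ⟨ρ, h⟩ := h
  rw [pm_pm] at h
  exact ⟨_, h⟩

theorem GoodC.of_sw {C : O → O → O → O → Prop} (i j : Fin 4) (h : GoodC (pm (Equiv.swap i j) C)) :
    GoodC C := h.of_pm

theorem pm_one (C : O → O → O → O → Prop) : pm 1 C = C := rfl

theorem pm_sw12 (C : O → O → O → O → Prop) : pm (Equiv.swap 0 1) C = fun a b c d => C b a c d := rfl
theorem pm_sw34 (C : O → O → O → O → Prop) : pm (Equiv.swap 2 3) C = fun a b c d => C a b d c := rfl
theorem pm_sw24 (C : O → O → O → O → Prop) : pm (Equiv.swap 1 3) C = fun a b c d => C a d c b := rfl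

theorem GoodC.cor {C : O → O → O → O → Prop} (h : CornerL C) : GoodC C := ⟨1, Or.inl h⟩
theorem GoodC.rig {C : O → O → O → O → Prop} (h : Rigid4 C) : GoodC C := ⟨1, Or.inr h⟩

/-- a three dimensional section that tiles. -/
theorem secTil {C : O → O → O → O → Prop} (h : Til4 C) (hn : NC4 C) {z : O}
    (H : ∀ s1 s2 s3, ∃ u1 u2 u3, C u1 u2 u3 z ∧ m u1 s1 ∧ m u2 s2 ∧ m u3 s3)
    (h0 : ¬ C none none none z) : CornerL C := by
  refine ⟨z, L3 ⟨H, ?_⟩ ⟨fun u v l => hn.c1 _ _ _ l, fun u v l => hn.c2 _ _ _ l,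
    fun u v l => hn.c3 _ _ _ l⟩ h0⟩
  intro u1 u2 u3 v1 v2 v3 hu hv
  have := h.sp _ _ _ _ _ _ _ _ hu hv
  simp at this
  tauto

theorem three_star {C : O → O → O → O → Prop} (h : Til4 C) (hn : NC4 C)
    (h0 : ¬ C none none none none) {z : O} (w : C none none none z) : CornerL C := by
  rcases z with _ | ⟨d, t0⟩
  · exact absurd w h0
  obtain ⟨t, ht⟩ := hn.c4 none none none d
  refine secTil h hn (z := some ⟨d, t⟩) (fun s1 s2 s3 => ?_) ht
  obtain ⟨x1, x2, x3, x4, hx, m1, m2, m3, m4⟩ := h.ex s1 s2 s3 (fun _ => t)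
  rcases h.sp _ _ _ _ _ _ _ _ hx w with e | e | e | e | ⟨e1, e2, e3, e4⟩
  · simp at e
  · simp at e
  · simp at e
  · have := (sep_some e m4).1
    subst this
    exact ⟨_, _, _, hx, m1, m2, m3⟩
  · subst e1 e2 e3 e4
    simp at m4
    subst m4
    exact absurd w ht

/-- the form of boxes avoiding a corner. -/
def RodForm (k1 : P) (b c : ℝ) (t2 t3 : ℤ → Prop) (c1 c2 c3 : O) : Prop :=
  ∃ p q r, c1 = some ⟨k1.l, p⟩ ∧ c2 = some ⟨b, q⟩ ∧ c3 = some ⟨c, r⟩ ∧ t2 q ∧ ¬ t3 r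

theorem rodform1 {F : P → P → P → Prop} {k1 k2 k3 : P} {a b c t1 t2 t3}
    (h : CAt F k1 k2 k3 a b c t1 t2 t3) {c1 c2 c3 : O}
    (H : ∀ x y z, F x y z → sep c1 (some x) ∨ sep c2 (some y) ∨ sep c3 (some z))
    (hk : sep c1 (some k1)) : RodForm k1 b c t2 t3 c1 c2 c3 := by
  obtain ⟨pk, rfl⟩ : ∃ p, c1 = some ⟨k1.l, p⟩ := sep_lab (p := k1.a) hk
  have na : ∀ p, ¬ sep (some ⟨k1.l, pk⟩ : O) (some ⟨a, p⟩) := by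
    intro p hp
    simp at hp
    exact h.l1 hp.1.symm
  obtain ⟨p1, hp1⟩ := h.n1
  obtain ⟨p0, hp0⟩ := h.n1'
  obtain ⟨q1, hq1⟩ := h.n2
  obtain ⟨q0, hq0⟩ := h.n2'
  obtain ⟨r1, hr1⟩ := h.n3
  obtain ⟨r0, hr0⟩ := h.n3'
  have e2 : ∃ q, c2 = some ⟨b, q⟩ := by
    rcases H _ _ _ (h.r3 p1 q0 hp1 hq0) with e | e | e
    · exact absurd e (na _)
    · exact sep_lab e
    · rcases H _ _ _ (h.b1 p1 q1 r1 hp1 hq1 hr1) with e' | e' | e'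
      · exact absurd e' (na _)
      · exact sep_lab e'
      · obtain ⟨r, rfl⟩ := sep_lab e'
        simp at e
        exact absurd e.1 h.l3
  have e3 : ∃ r, c3 = some ⟨c, r⟩ := by
    rcases H _ _ _ (h.r2 p0 r1 hr1 hp0) with e | e | e
    · exact absurd e (na _)
    · obtain ⟨q, rfl⟩ := e2
      simp at e
      exact absurd e.1 h.l2
    · exact sep_lab e
  obtain ⟨q, rfl⟩ := e2
  obtain ⟨r, rfl⟩ := e3
  refine ⟨pk, q, r, rfl, rfl, rfl, ?_, ?_⟩
  · by_contra hq
    rcases H _ _ _ (h.r3 p1 q hp1 hq) with e | e | e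
    · exact absurd e (na _)
    · simp at e
    · simp at e; exact absurd e.1 h.l3
  · intro hr
    rcases H _ _ _ (h.r2 p0 r hr hp0) with e | e | e
    · exact absurd e (na _)
    · simp at e; exact absurd e.1 h.l2
    · simp at e

theorem rodform {F : P → P → P → Prop} {k1 k2 k3 : P} {a b c t1 t2 t3}
    (h : CAt F k1 k2 k3 a b c t1 t2 t3) {c1 c2 c3 : O}
    (H : ∀ x y z, F x y z → sep c1 (some x) ∨ sep c2 (some y) ∨ sep c3 (some z))
    (hk : sep c1 (some k1) ∨ sep c2 (some k2) ∨ sep c3 (some k3)) :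
    RodForm k1 b c t2 t3 c1 c2 c3 ∨ RodForm k2 c a t3 t1 c2 c3 c1 ∨
    RodForm k3 a b t1 t2 c3 c1 c2 := by
  rcases hk with hk | hk | hk
  · exact Or.inl (rodform1 h H hk)
  · refine Or.inr (Or.inl (rodform1 h.rot.rot (fun x y z hx => ?_) hk))
    have := H _ _ _ hx
    tauto
  · refine Or.inr (Or.inr (rodform1 h.rot (fun x y z hx => ?_) hk))
    have := H _ _ _ hx
    tauto

/-- given rod form of `c` and of `x` meeting it, they agree. -/
theorem rodform_agree {k1 k2 k3 : P} {a b c : ℝ} {t1 t2 t3 : ℤ → Prop} {c1 c2 c3 x1 x2 x3 : O}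
    (hc : RodForm k1 b c t2 t3 c1 c2 c3)
    (hx : RodForm k1 b c t2 t3 x1 x2 x3 ∨ RodForm k2 c a t3 t1 x2 x3 x1 ∨
      RodForm k3 a b t1 t2 x3 x1 x2) {s1 s2 s3 : S}
    (m1 : m c1 s1) (m2 : m c2 s2) (m3 : m c3 s3) (m1' : m x1 s1) (m2' : m x2 s2) (m3' : m x3 s3) :
    x1 = c1 ∧ x2 = c2 ∧ x3 = c3 := by
  obtain ⟨p, q, r, rfl, rfl, rfl, h2, h3⟩ := hc
  simp only [mO_some] at m1 m2 m3
  rcases hx with ⟨p', q', r', rfl, rfl, rfl, h2', h3'⟩ | ⟨p', q', r', rfl, rfl, rfl, h2', h3'⟩ |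
    ⟨p', q', r', rfl, rfl, rfl, h2', h3'⟩ <;> simp only [mO_some] at m1' m2' m3'
  · subst m1 m2 m3 m1' m2' m3'; exact ⟨rfl, rfl, rfl⟩
  · subst m3; subst m3'; exact absurd h2' h3
  · subst m2; subst m2'; exact absurd h2 h3'

theorem caseB {C : O → O → O → O → Prop} (h : Til4 C) (hn : NC4 C)
    (h0 : ¬ C none none none none)
    (one : ∀ c1 c2 c3, C c1 c2 c3 none → c1 ≠ none ∧ c2 ≠ none ∧ c3 ≠ none)
    {w1 w2 w3 : O} (w : C w1 w2 w3 none) : CornerL C ∨ Rigid4 C := by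
  by_contra hcon
  push Not at hcon
  obtain ⟨hnc, hnr⟩ := hcon
  obtain ⟨n1, n2, n3⟩ := one _ _ _ w
  obtain ⟨w1, rfl⟩ := Option.ne_none_iff_exists'.1 n1
  obtain ⟨w2, rfl⟩ := Option.ne_none_iff_exists'.1 n2
  obtain ⟨w3, rfl⟩ := Option.ne_none_iff_exists'.1 n3
  -- failing rigidity gives a box
  obtain ⟨b1, b2, b3, mb1, mb2, mb3, hb, hbne⟩ : ∃ b1 b2 b3 : O, m b1 (fun _ => w1.a) ∧
      m b2 (fun _ => w2.a) ∧ m b3 (fun _ => w3.a) ∧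
      (∀ c1 c2 c3 v, C c1 c2 c3 v → v ≠ none → sep b1 c1 ∨ sep b2 c2 ∨ sep b3 c3) ∧
      ¬ (b1 = some w1 ∧ b2 = some w2 ∧ b3 = some w3) := by
    by_contra hc
    apply hnr
    refine ⟨some w1, some w2, some w3, fun _ => w1.a, fun _ => w2.a, fun _ => w3.a, w, by simp,
      by simp, by simp, ?_⟩
    intro b1 b2 b3 m1 m2 m3 hb
    by_contra hne
    exact hc ⟨b1, b2, b3, m1, m2, m3, hb, hne⟩
  -- make it real
  obtain ⟨b1, b2, b3, mb1, mb2, mb3, hb, hbne⟩ : ∃ b1 b2 b3 : P, m b1 (fun _ => w1.a) ∧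
      m b2 (fun _ => w2.a) ∧ m b3 (fun _ => w3.a) ∧
      (∀ c1 c2 c3 v, C c1 c2 c3 v → v ≠ none → sep c1 (some b1) ∨ sep c2 (some b2) ∨ sep c3 (some b3)) ∧
      ¬ (b1 = w1 ∧ b2 = w2 ∧ b3 = w3) := by
    have fix : ∀ (b : O) (w : P), m b (fun _ => w.a) → ∃ b' : P, m b' (fun _ => w.a) ∧
        (∀ c, sep b c → sep c (some b')) ∧ (b' = w → b = some w) := by
      intro b w hm
      rcases b with _ | b
      · refine ⟨⟨w.l + 1, w.a⟩, by simp, by simp, fun e => ?_⟩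
        have := congrArg P.l e
        simp at this
      · exact ⟨b, by simpa using hm, fun c hc => sepO_symm hc, fun e => by rw [e]⟩
    obtain ⟨b1', a1, a2, a3⟩ := fix b1 w1 mb1
    obtain ⟨b2', a4, a5, a6⟩ := fix b2 w2 mb2
    obtain ⟨b3', a7, a8, a9⟩ := fix b3 w3 mb3
    refine ⟨b1', b2', b3', a1, a4, a7, ?_, ?_⟩
    · intro c1 c2 c3 v hc hv
      rcases hb c1 c2 c3 v hc hv with e | e | e
      · exact Or.inl (a2 _ e)
      · exact Or.inr (Or.inl (a5 _ e))
      · exact Or.inr (Or.inr (a8 _ e))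
    · rintro ⟨e1, e2, e3⟩
      exact hbne ⟨a3 e1, a6 e2, a9 e3⟩
  obtain ⟨a, b, c, t1, t2, t3, hcor⟩ := L3loc
    (F := fun x y z => C (some x) (some y) (some z) none) (k1 := b1) (k2 := b2) (k3 := b3)
    (by
      intro s1 s2 s3 m1 m2 m3
      obtain ⟨x1, x2, x3, x4, hx, mx1, mx2, mx3, mx4⟩ := h.ex s1 s2 s3 (fun _ => 0)
      have e4 : x4 = none := by
        by_contra h4
        rcases hb _ _ _ _ hx h4 with e | e | e
        · exact notsepO mx1 (by simpa using m1) e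
        · exact notsepO mx2 (by simpa using m2) e
        · exact notsepO mx3 (by simpa using m3) e
      subst e4
      obtain ⟨n1, n2, n3⟩ := one _ _ _ hx
      obtain ⟨x1, rfl⟩ := Option.ne_none_iff_exists'.1 n1
      obtain ⟨x2, rfl⟩ := Option.ne_none_iff_exists'.1 n2
      obtain ⟨x3, rfl⟩ := Option.ne_none_iff_exists'.1 n3
      exact ⟨_, _, _, hx, by simpa using mx1, by simpa using mx2, by simpa using mx3⟩)
    (by
      intro x1 x2 x3 y1 y2 y3 hx hy
      have := h.sp _ _ _ _ _ _ _ _ hx hy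
      simpa using this)
    (fun u v l => hn.c1 _ _ _ l) (fun u v l => hn.c2 _ _ _ l) (fun u v l => hn.c3 _ _ _ l)
    (by
      intro hc
      rcases h.sp _ _ _ _ _ _ _ _ hc w with e | e | e | e | ⟨e1, e2, e3, -⟩
      · exact notsepO (σ := fun _ => w1.a) (by simpa using mb1) (by simp) e
      · exact notsepO (σ := fun _ => w2.a) (by simpa using mb2) (by simp) e
      · exact notsepO (σ := fun _ => w3.a) (by simpa using mb3) (by simp) e
      · simp at e
      · simp only [Option.some.injEq] at e1 e2 e3
        exact hbne ⟨e1, e2, e3⟩)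
  have form : ∀ c1 c2 c3 v, C c1 c2 c3 v → v ≠ none → RodForm b1 b c t2 t3 c1 c2 c3 ∨
      RodForm b2 c a t3 t1 c2 c3 c1 ∨ RodForm b3 a b t1 t2 c3 c1 c2 := by
    intro c1 c2 c3 v hc hv
    refine rodform hcor (fun x y z hx => ?_) (hb _ _ _ _ hc hv)
    rcases h.sp _ _ _ _ _ _ _ _ hc hx with e | e | e | e | ⟨-, -, -, e⟩
    · exact Or.inl e
    · exact Or.inr (Or.inl e)
    · exact Or.inr (Or.inr e)
    · simp at e
    · exact absurd e hv
  by_cases hall : ∀ c1 c2 c3 v, C c1 c2 c3 v → v = none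
  · apply hnc
    refine secTil h hn (z := none) (fun s1 s2 s3 => ?_) h0
    obtain ⟨x1, x2, x3, x4, hx, mx1, mx2, mx3, mx4⟩ := h.ex s1 s2 s3 (fun _ => 0)
    have := hall _ _ _ _ hx
    subst this
    exact ⟨_, _, _, hx, mx1, mx2, mx3⟩
  · push Not at hall
    obtain ⟨c1, c2, c3, v, hc, hv⟩ := hall
    obtain ⟨y, rfl⟩ := Option.ne_none_iff_exists'.1 hv
    obtain ⟨t', ht'⟩ := hn.c4 c1 c2 c3 y.l
    apply ht'
    have pt : ∀ u : O, ∃ s : S, m u s := by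
      intro u; rcases u with _ | u
      · exact ⟨fun _ => 0, by simp⟩
      · exact ⟨fun _ => u.a, by simp⟩
    obtain ⟨s1, m1⟩ := pt c1
    obtain ⟨s2, m2⟩ := pt c2
    obtain ⟨s3, m3⟩ := pt c3
    obtain ⟨x1, x2, x3, x4, hx, mx1, mx2, mx3, mx4⟩ := h.ex s1 s2 s3 (fun _ => t')
    rcases h.sp _ _ _ _ _ _ _ _ hx hc with e | e | e | e | ⟨e1, e2, e3, e4⟩
    · exact absurd e (notsepO mx1 m1)
    · exact absurd e (notsepO mx2 m2)
    · exact absurd e (notsepO mx3 m3)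
    · have := (sep_some e mx4).1
      subst this
      have fx := form _ _ _ _ hx (by simp)
      have : x1 = c1 ∧ x2 = c2 ∧ x3 = c3 := by
        rcases form _ _ _ _ hc hv with f | f | f
        · exact rodform_agree f fx m1 m2 m3 mx1 mx2 mx3
        · have := rodform_agree (k1 := b2) (k2 := b3) (k3 := b1) f (by tauto) m2 m3 m1 mx2 mx3 mx1
          tauto
        · have := rodform_agree (k1 := b3) (k2 := b1) (k3 := b2) f (by tauto) m3 m1 m2 mx3 mx1 mx2
          tauto
      obtain ⟨rfl, rfl, rfl⟩ := this
      exact hx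
    · subst e1 e2 e3 e4
      simp at mx4
      subst mx4
      exact hc

end Kel

set_option linter.unusedVariables false
set_option linter.unusedSimpArgs false
namespace Kel
open Pce

theorem Til4.line1 {C : O → O → O → O → Prop} (h : Til4 C) (hn : NC4 C) {u2 u3 u4 : O}
    (H : ∀ s, ∃ u, C u u2 u3 u4 ∧ m u s) : C none u2 u3 u4 := by
  refine L1' (C := fun u => C u u2 u3 u4) ⟨H, fun u v hu hv => ?_⟩ (fun l => hn.c1 _ _ _ l)
  have := h.sp _ _ _ _ _ _ _ _ hu hv
  simpa using this

theorem Til4.line4 {C : O → O → O → O → Prop} (h : Til4 C) (hn : NC4 C) {u2 u3 u4 : O}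
    (H : ∀ s, ∃ u, C u2 u3 u4 u ∧ m u s) : C u2 u3 u4 none := by
  refine L1' (C := fun u => C u2 u3 u4 u) ⟨H, fun u v hu hv => ?_⟩ (fun l => hn.c4 _ _ _ l)
  have := h.sp _ _ _ _ _ _ _ _ hu hv
  simpa using this

theorem Til4.plane12 {C : O → O → O → O → Prop} (h : Til4 C) (hn : NC4 C) {u3 u4 : O}
    (H : ∀ s1 s2, ∃ u1 u2, C u1 u2 u3 u4 ∧ m u1 s1 ∧ m u2 s2) : C none none u3 u4 := by
  refine L2 (C := fun u v => C u v u3 u4) ⟨H, fun u1 u2 v1 v2 hu hv => ?_⟩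
    ⟨fun u l => hn.c1 _ _ _ l, fun u l => hn.c2 _ _ _ l⟩
  have := h.sp _ _ _ _ _ _ _ _ hu hv
  simpa using this

theorem Til4.plane14 {C : O → O → O → O → Prop} (h : Til4 C) (hn : NC4 C) {u3 u4 : O}
    (H : ∀ s1 s2, ∃ u1 u2, C u1 u3 u4 u2 ∧ m u1 s1 ∧ m u2 s2) : C none u3 u4 none := by
  refine L2 (C := fun u v => C u u3 u4 v) ⟨H, fun u1 u2 v1 v2 hu hv => ?_⟩
    ⟨fun u l => hn.c1 _ _ _ l, fun u l => hn.c4 _ _ _ l⟩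
  have := h.sp _ _ _ _ _ _ _ _ hu hv
  simpa using this

structure CA (C : O → O → O → O → Prop) (a b : ℝ) (q0 r0 : ℤ) : Prop where
  h : Til4 C
  n : NC4 C
  w : C none none (some ⟨a, q0⟩) (some ⟨b, r0⟩)
  ng : ¬ GoodC C

theorem CA.sw12 {C : O → O → O → O → Prop} {a b q0 r0} (X : CA C a b q0 r0) :
    CA (fun x y z w => C y x z w) a b q0 r0 :=
  ⟨X.h.pm (Equiv.swap 0 1), X.n.pm (Equiv.swap 0 1), X.w,
    fun h => X.ng (GoodC.of_pm (Equiv.swap 0 1) h)⟩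

theorem CA.sw34 {C : O → O → O → O → Prop} {a b q0 r0} (X : CA C a b q0 r0) :
    CA (fun x y z w => C x y w z) b a r0 q0 :=
  ⟨X.h.pm (Equiv.swap 2 3), X.n.pm (Equiv.swap 2 3), X.w,
    fun h => X.ng (GoodC.of_pm (Equiv.swap 2 3) h)⟩

def nb (b : ℝ) (v : O) : Prop := ∀ r, v ≠ some ⟨b, r⟩

theorem nb.m_of {b : ℝ} {v : O} (h : nb b v) {s : S} {r : ℤ} (hm : m v (Function.update s b r)) :
    m v s := by
  rcases v with _ | ⟨l, p⟩
  · simp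
  · have : l ≠ b := by
      rintro rfl; exact h p rfl
    simpa [Function.update_of_ne this] using hm

theorem CA.cov {C : O → O → O → O → Prop} {a b q0 r0} (X : CA C a b q0 r0) {q : ℤ} (hq : q ≠ q0)
    (s1 s2 s4 : S) (h4 : s4 b = r0) : ∃ u1 u2 v, C u1 u2 (some ⟨a, q⟩) v ∧ m u1 s1 ∧ m u2 s2 ∧
      m v s4 ∧ (v = some ⟨b, r0⟩ ∨ nb b v) := by
  obtain ⟨u1, u2, u3, v, hu, m1, m2, m3, m4⟩ := X.h.ex s1 s2 (fun _ => q) s4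
  have e3 : u3 = some ⟨a, q⟩ := by
    rcases X.h.sp _ _ _ _ _ _ _ _ hu X.w with e | e | e | e | ⟨e1, e2, e3, e4⟩
    · simp at e
    · simp at e
    · exact (sep_some e m3).1
    · exact absurd h4 (sep_some e m4).2
    · subst e3; simp at m3; exact absurd m3 hq
  subst e3
  refine ⟨u1, u2, v, hu, m1, m2, m4, ?_⟩
  by_cases hv : nb b v
  · exact Or.inr hv
  · simp only [nb, not_forall, not_not] at hv
    obtain ⟨r, rfl⟩ := hv
    simp at m4
    left; rw [← m4, h4]

def NN (C : O → O → O → O → Prop) (a b : ℝ) (q : ℤ) (s1 s2 : S) : Prop :=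
  ∃ u1 u2 v, C u1 u2 (some ⟨a, q⟩) v ∧ nb b v ∧ m u1 s1 ∧ m u2 s2

def YY (C : O → O → O → O → Prop) (a b : ℝ) (r0 : ℤ) (q : ℤ) (s1 s2 : S) : Prop :=
  ∃ u1 u2, C u1 u2 (some ⟨a, q⟩) (some ⟨b, r0⟩) ∧ m u1 s1 ∧ m u2 s2

theorem CA.Nex {C : O → O → O → O → Prop} {a b q0 r0} (X : CA C a b q0 r0) {q : ℤ}
    (hQ : ¬ C none none (some ⟨a, q⟩) (some ⟨b, r0⟩)) : ∃ s1 s2, NN C a b q s1 s2 := by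
  have hq : q ≠ q0 := by
    rintro rfl; exact hQ X.w
  by_contra hc
  apply hQ
  refine X.h.plane12 X.n (fun s1 s2 => ?_)
  obtain ⟨u1, u2, v, hu, m1, m2, m3, e | e⟩ := X.cov hq s1 s2 (fun _ => r0) rfl
  · subst e
    exact ⟨_, _, hu, m1, m2⟩
  · exact absurd ⟨s1, s2, u1, u2, v, hu, e, m1, m2⟩ hc

theorem CA.sepNM {C : O → O → O → O → Prop} {a b q0 r0} (X : CA C a b q0 r0) {q r : ℤ}
    {u1 u2 v z1 z2 g : O} (hu : C u1 u2 (some ⟨a, q⟩) v) (hv : nb b v)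
    (hz : C z1 z2 g (some ⟨b, r⟩)) (hg : nb a g) : sep u1 z1 ∨ sep u2 z2 := by
  rcases X.h.sp _ _ _ _ _ _ _ _ hu hz with e | e | e | e | ⟨e1, e2, e3, e4⟩
  · exact Or.inl e
  · exact Or.inr e
  · obtain ⟨p, hp⟩ := sep_lab' e
    exact absurd hp (hg _)
  · obtain ⟨p, hp⟩ := sep_lab e
    exact absurd hp (hv _)
  · exact absurd e4 (hv _)

theorem CA.MY {C : O → O → O → O → Prop} {a b q0 r0} (X : CA C a b q0 r0) {q r : ℤ} (hq : q ≠ q0)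
    {s1 s2 : S} (hM : NN (fun x y z w => C x y w z) b a r s1 s2) : YY C a b r0 q s1 s2 := by
  obtain ⟨z1, z2, g, hz, hg, mz1, mz2⟩ := hM
  obtain ⟨u1, u2, v, hu, m1, m2, m3, e | e⟩ := X.cov hq s1 s2 (fun _ => r0) rfl
  · subst e
    exact ⟨_, _, hu, m1, m2⟩
  · rcases X.sepNM hu e hz hg with e | e
    · exact absurd e (notsepO m1 mz1)
    · exact absurd e (notsepO m2 mz2)

theorem CA.star {C : O → O → O → O → Prop} {a b q0 r0} (X : CA C a b q0 r0) {q : ℤ} (hq : q ≠ q0)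
    {x y : ℝ} {p s : ℤ} {z1 z2 : O} {s1 s2 : S}
    (hA : C (some ⟨x, p⟩) z2 (some ⟨a, q⟩) (some ⟨b, r0⟩))
    (hB : C z1 (some ⟨y, s⟩) (some ⟨a, q⟩) (some ⟨b, r0⟩))
    (m2 : m z2 s2) (m1 : m z1 s1) (n1 : s1 x ≠ p) (n2 : s2 y ≠ s) :
    C (some ⟨x, s1 x⟩) (some ⟨y, s2 y⟩) (some ⟨a, q⟩) (some ⟨b, r0⟩) := by
  by_contra hc
  have key : ∀ s4 : S, ∃ v, C (some ⟨x, s1 x⟩) (some ⟨y, s2 y⟩) (some ⟨a, q⟩) v ∧ m v s4 := by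
    intro s4
    obtain ⟨u1, u2, v, hu, mu1, mu2, mv, hv⟩ := X.cov hq s1 s2 (Function.update s4 b r0) (by simp)
    have nv : ¬ sep v (some ⟨b, r0⟩) := by
      rcases hv with rfl | hv
      · simp
      · intro e
        obtain ⟨p, hp⟩ := sep_lab e
        exact hv _ hp
    have e1 : u1 = some ⟨x, s1 x⟩ := by
      rcases X.h.sp _ _ _ _ _ _ _ _ hu hA with e | e | e | e | ⟨e1, e2, e3, e4⟩
      · exact (sep_some e mu1).1
      · exact absurd e (notsepO mu2 m2)
      · simp at e
      · exact absurd e nv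
      · subst e1; simp at mu1; exact absurd mu1 n1
    have e2 : u2 = some ⟨y, s2 y⟩ := by
      rcases X.h.sp _ _ _ _ _ _ _ _ hu hB with e | e | e | e | ⟨e1, e2, e3, e4⟩
      · exact absurd e (notsepO mu1 m1)
      · exact (sep_some e mu2).1
      · simp at e
      · exact absurd e nv
      · subst e2; simp at mu2; exact absurd mu2 n2
    subst e1 e2
    rcases hv with rfl | hv
    · exact absurd hu hc
    · exact ⟨v, hu, hv.m_of mv⟩
  have hl := X.h.line4 X.n key
  apply X.ng
  apply GoodC.rig
  refine ⟨_, _, _, s1, s2, fun _ => q, hl, by simp, by simp, by simp, ?_⟩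
  intro b1 b2 b3 k1 k2 k3 H
  refine ⟨?_, ?_, ?_⟩
  · rcases H _ _ _ _ hA (by simp) with e | e | e
    · exact (sep_some e k1).1
    · exact absurd e (notsepO k2 m2)
    · exact absurd e (notsepO k3 (by simp))
  · rcases H _ _ _ _ hB (by simp) with e | e | e
    · exact absurd e (notsepO k1 m1)
    · exact (sep_some e k2).1
    · exact absurd e (notsepO k3 (by simp))
  · rcases H _ _ _ _ X.w (by simp) with e | e | e
    · simp at e
    · simp at e
    · exact (sep_some e k3).1

def Str2 (C : O → O → O → O → Prop) (a b : ℝ) (r0 q : ℤ) (y : ℝ) : Prop :=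
  (∀ s, C none (some ⟨y, s⟩) (some ⟨a, q⟩) none ∨
    C none (some ⟨y, s⟩) (some ⟨a, q⟩) (some ⟨b, r0⟩)) ∧
  ∃ s, C none (some ⟨y, s⟩) (some ⟨a, q⟩) none

theorem CA.caseI {C : O → O → O → O → Prop} {a b q0 r0} (X : CA C a b q0 r0) {q : ℤ} (hq : q ≠ q0)
    {y : ℝ} {s0 : ℤ} (hy : C none (some ⟨y, s0⟩) (some ⟨a, q⟩) (some ⟨b, r0⟩)) :
    Str2 C a b r0 q y := by
  have main : ∀ s, C none (some ⟨y, s⟩) (some ⟨a, q⟩) none ∨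
    C none (some ⟨y, s⟩) (some ⟨a, q⟩) (some ⟨b, r0⟩) := by
    intro s
    by_cases hs : s = s0
    · subst hs; exact Or.inr hy
    by_cases hm : ∃ u, C u (some ⟨y, s⟩) (some ⟨a, q⟩) (some ⟨b, r0⟩)
    · obtain ⟨u, hu⟩ := hm
      rcases u with _ | ⟨x, p⟩
      · exact Or.inr hu
      exfalso
      obtain ⟨p', hp'⟩ := X.n.c1 (some ⟨y, s⟩) (some ⟨a, q⟩) (some ⟨b, r0⟩) x
      apply hp'
      by_cases hpp : p' = p
      · rw [hpp]; exact hu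
      exact X.star hq (s1 := fun _ => p') (s2 := fun _ => s) hu hy (by simp) (by simp) hpp hs
    · left
      refine X.h.plane14 X.n (fun s1 s4 => ?_)
      obtain ⟨u1, u2, v, hu, mu1, mu2, mv, hv⟩ :=
        X.cov hq s1 (fun _ => s) (Function.update s4 b r0) (by simp)
      have e2 : u2 = some ⟨y, s⟩ := by
        rcases X.h.sp _ _ _ _ _ _ _ _ hu hy with e | e | e | e | ⟨e1, e2, e3, e4⟩
        · simp at e
        · exact (sep_some e mu2).1
        · simp at e
        · rcases hv with rfl | hv
          · simp at e
          · obtain ⟨p, hp⟩ := sep_lab e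
            exact absurd hp (hv _)
        · subst e2; simp at mu2; exact absurd mu2 hs
      subst e2
      rcases hv with rfl | hv
      · exact absurd ⟨_, hu⟩ hm
      · exact ⟨_, _, hu, mu1, hv.m_of mv⟩
  refine ⟨main, ?_⟩
  obtain ⟨s, hs⟩ := X.n.c2 none (some ⟨a, q⟩) (some ⟨b, r0⟩) y
  exact ⟨s, (main s).resolve_right hs⟩

def HasLine (N : S → S → Prop) : Prop := (∃ s2, ∀ s1, N s1 s2) ∨ (∃ s1, ∀ s2, N s1 s2)

theorem CA.caseII {C : O → O → O → O → Prop} {a b q0 r0} (X : CA C a b q0 r0) {q : ℤ} (hq : q ≠ q0)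
    (ns : ∀ u1 u2, C u1 u2 (some ⟨a, q⟩) (some ⟨b, r0⟩) → u1 ≠ none ∧ u2 ≠ none)
    {y : ℝ} (lay : ∀ u1 u2 v, C u1 u2 (some ⟨a, q⟩) v → m v (fun _ => r0) → ∃ s, u2 = some ⟨y, s⟩) :
    ¬ HasLine (YY C a b r0 q) ∧ HasLine (NN C a b q) := by
  have row : ∃ s, ∀ x p, ¬ C (some ⟨x, p⟩) (some ⟨y, s⟩) (some ⟨a, q⟩) (some ⟨b, r0⟩) := by
    by_contra hc
    push Not at hc
    choose x p hx using hc
    have same : ∀ s s', x s = x s' := by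
      intro s s'
      by_contra hne
      have hss : s ≠ s' := by
        rintro rfl; exact hne rfl
      obtain ⟨p', hp'⟩ := X.n.c1 (some ⟨y, s⟩) (some ⟨a, q⟩) (some ⟨b, r0⟩) (x s)
      apply hp'
      by_cases hpp : p' = p s
      · rw [hpp]; exact hx s
      have := X.star hq (s1 := Function.update (fun _ => p s') (x s) p') (s2 := fun _ => s)
        (hx s) (hx s') (by simp) (by simp [Function.update_of_ne (Ne.symm hne)]) (by simpa using hpp) hss
      simpa using this
    obtain ⟨t, ht⟩ := X.n.c2 (some ⟨x 0, p 0⟩) (some ⟨a, q⟩) (some ⟨b, r0⟩) y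
    apply ht
    by_cases ht0 : t = 0
    · rw [ht0]; exact hx 0
    have h1 := hx t
    rw [same t 0] at h1
    by_cases hpp : p 0 = p t
    · rw [hpp]; exact h1
    exact X.star hq (s1 := fun _ => p 0) (s2 := fun _ => t) h1 (hx 0) (by simp) (by simp) hpp ht0
  obtain ⟨s, hs⟩ := row
  refine ⟨?_, Or.inl ⟨fun _ => s, fun s1 => ?_⟩⟩
  · rintro (⟨s2, hl⟩ | ⟨s1, hl⟩)
    · have : C none (some ⟨y, s2 y⟩) (some ⟨a, q⟩) (some ⟨b, r0⟩) := by
        refine X.h.line1 X.n (fun s1 => ?_)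
        obtain ⟨u1, u2, hu, m1, m2⟩ := hl s1
        obtain ⟨t, rfl⟩ := lay _ _ _ hu (by simp)
        simp at m2
        rw [m2]
        exact ⟨u1, hu, m1⟩
      exact (ns _ _ this).1 rfl
    · obtain ⟨u1, u2, hu, m1, m2⟩ := hl (fun _ => s)
      obtain ⟨t, rfl⟩ := lay _ _ _ hu (by simp)
      simp at m2
      subst m2
      obtain ⟨⟨x, p⟩, rfl⟩ := Option.ne_none_iff_exists'.1 (ns _ _ hu).1
      exact hs _ _ hu
  · obtain ⟨u1, u2, v, hu, mu1, mu2, mv, hv⟩ := X.cov hq s1 (fun _ => s) (fun _ => r0) rfl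
    rcases hv with rfl | hv
    · exfalso
      obtain ⟨t, rfl⟩ := lay _ _ _ hu (by simp)
      simp at mu2
      subst mu2
      obtain ⟨⟨x, p⟩, rfl⟩ := Option.ne_none_iff_exists'.1 (ns _ _ hu).1
      exact hs _ _ hu
    · exact ⟨_, _, _, hu, hv, mu1, mu2⟩

def Str1 (C : O → O → O → O → Prop) (a b : ℝ) (r0 q : ℤ) (x : ℝ) : Prop :=
  Str2 (fun u1 u2 u3 u4 => C u2 u1 u3 u4) a b r0 q x

theorem HasLine.mono {M N : S → S → Prop} (h : HasLine M) (H : ∀ s1 s2, M s1 s2 → N s1 s2) :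
    HasLine N := by
  rcases h with ⟨s, h⟩ | ⟨s, h⟩
  · exact Or.inl ⟨s, fun t => H _ _ (h t)⟩
  · exact Or.inr ⟨s, fun t => H _ _ (h t)⟩

theorem HasLine.swap {M N : S → S → Prop} (h : HasLine M) (H : ∀ s1 s2, M s1 s2 → N s2 s1) :
    HasLine N := by
  rcases h with ⟨s, h⟩ | ⟨s, h⟩
  · exact Or.inr ⟨s, fun t => H _ _ (h t)⟩
  · exact Or.inl ⟨s, fun t => H _ _ (h t)⟩

theorem Str2.line {C : O → O → O → O → Prop} {a b r0 q y} (h : Str2 C a b r0 q y) :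
    HasLine (NN C a b q) := by
  obtain ⟨-, s, hs⟩ := h
  exact Or.inl ⟨fun _ => s, fun s1 => ⟨_, _, _, hs, by simp [nb], by simp, by simp⟩⟩

theorem NN.sw {C : O → O → O → O → Prop} {a b q s1 s2}
    (h : NN (fun u1 u2 u3 u4 => C u2 u1 u3 u4) a b q s1 s2) : NN C a b q s2 s1 := by
  obtain ⟨u1, u2, v, h1, h2, h3, h4⟩ := h
  exact ⟨u2, u1, v, h1, h2, h4, h3⟩

theorem YY.sw {C : O → O → O → O → Prop} {a b q r0 s1 s2}
    (h : YY C a b r0 q s1 s2) : YY (fun u1 u2 u3 u4 => C u2 u1 u3 u4) a b r0 q s2 s1 := by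
  obtain ⟨u1, u2, h1, h3, h4⟩ := h
  exact ⟨u2, u1, h1, h4, h3⟩

theorem Str1.line {C : O → O → O → O → Prop} {a b r0 q y} (h : Str1 C a b r0 q y) :
    HasLine (NN C a b q) := (Str2.line h).swap (fun s1 s2 h => h.sw)

theorem CA.lemA {C : O → O → O → O → Prop} {a b q0 r0} (X : CA C a b q0 r0) {q r : ℤ}
    (hQ : ¬ C none none (some ⟨a, q⟩) (some ⟨b, r0⟩))
    (hR : ¬ C none none (some ⟨a, q0⟩) (some ⟨b, r⟩)) :
    (∃ y, Str2 C a b r0 q y) ∨ (∃ x, Str1 C a b r0 q x) ∨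
      (¬ HasLine (YY C a b r0 q) ∧ HasLine (NN C a b q)) := by
  have hq : q ≠ q0 := by
    rintro rfl; exact hQ X.w
  obtain ⟨t1, t2, hM⟩ := X.sw34.Nex hR
  have hN : ∀ v, nb b v → ¬ C none none (some ⟨a, q⟩) v := by
    intro v hv hc
    obtain ⟨z1, z2, g, hz, hg, -, -⟩ := hM
    simpa using X.sepNM hc hv hz hg
  obtain ⟨y1, y2, hy, -, -⟩ := X.MY hq hM
  by_cases ns : ∀ u1 u2, C u1 u2 (some ⟨a, q⟩) (some ⟨b, r0⟩) → u1 ≠ none ∧ u2 ≠ none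
  · right; right
    have hT : Til2 (fun u1 u2 => ∃ v, C u1 u2 (some ⟨a, q⟩) v ∧ m v (fun _ => r0)) := by
      refine ⟨?_, ?_⟩
      · intro s1 s2
        obtain ⟨u1, u2, v, hu, mu1, mu2, mv, hv⟩ := X.cov hq s1 s2 (fun _ => r0) rfl
        exact ⟨u1, u2, ⟨v, hu, mv⟩, mu1, mu2⟩
      · rintro u1 u2 v1 v2 ⟨v, hv, mv⟩ ⟨w, hw, mw⟩
        have h1 := X.h.sp _ _ _ _ _ _ _ _ hv hw
        have h2 := notsepO mv mw
        simp only [sepO_irrefl, true_and, false_or] at h1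
        tauto
    rcases L2lay hT with ⟨v, hv, mv⟩ | ⟨x, hx⟩ | ⟨y, hy⟩
    · exfalso
      by_cases hb : nb b v
      · exact hN _ hb hv
      · simp only [nb, not_forall, not_not] at hb
        obtain ⟨r, rfl⟩ := hb
        simp at mv
        subst mv
        exact hQ hv
    · have := X.sw12.caseII hq (fun u1 u2 h => (ns _ _ h).symm) (y := x)
        (fun u1 u2 v h1 h2 => hx _ _ ⟨v, h1, h2⟩)
      exact ⟨fun h => this.1 (h.swap (fun _ _ h => h.sw)), this.2.swap (fun _ _ h => h.sw)⟩
    · exact X.caseII hq ns (y := y) (fun u1 u2 v h1 h2 => hy _ _ ⟨v, h1, h2⟩)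
  · push Not at ns
    obtain ⟨u1, u2, hu, hne⟩ := ns
    rcases u1 with _ | u1
    · rcases u2 with _ | ⟨y, s⟩
      · exact absurd hu hQ
      · exact Or.inl ⟨y, X.caseI hq hu⟩
    · have := hne (by simp)
      subst this
      exact Or.inr (Or.inl ⟨u1.l, X.sw12.caseI hq (s0 := u1.a) hu⟩)

theorem CA.lemA2 {C : O → O → O → O → Prop} {a b q0 r0} (X : CA C a b q0 r0) {q r : ℤ}
    (hQ : ¬ C none none (some ⟨a, q⟩) (some ⟨b, r0⟩))
    (hR : ¬ C none none (some ⟨a, q0⟩) (some ⟨b, r⟩)) :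
    (∃ y, Str2 C a b r0 q y) ∨ (∃ x, Str1 C a b r0 q x) := by
  have hq : q ≠ q0 := by
    rintro rfl; exact hQ X.w
  rcases X.lemA hQ hR with h | h | ⟨h, -⟩
  · exact Or.inl h
  · exact Or.inr h
  · exfalso
    apply h
    have : HasLine (NN (fun x y z w => C x y w z) b a r) := by
      rcases X.sw34.lemA hR hQ with ⟨y, h⟩ | ⟨x, h⟩ | ⟨-, h⟩
      · exact h.line
      · exact h.line
      · exact h
    exact this.mono (fun s1 s2 h => X.MY hq h)

theorem CA.agree {C : O → O → O → O → Prop} {a b q0 r0} (X : CA C a b q0 r0) {q r : ℤ}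
    (hQ : ¬ C none none (some ⟨a, q⟩) (some ⟨b, r0⟩))
    (hR : ¬ C none none (some ⟨a, q0⟩) (some ⟨b, r⟩)) {y : ℝ} (h : Str2 C a b r0 q y) :
    Str2 (fun x y z w => C x y w z) b a q0 r y := by
  obtain ⟨-, s, hs⟩ := h
  rcases X.sw34.lemA2 hR hQ with ⟨y', h'⟩ | ⟨x, -, t, ht⟩
  · obtain ⟨-, t, ht⟩ := id h'
    have := X.h.sp _ _ _ _ _ _ _ _ hs ht
    simp at this
    rw [this.1]
    exact h'
  · have := X.h.sp _ _ _ _ _ _ _ _ hs ht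
    simp at this

theorem CA.fill {C : O → O → O → O → Prop} {a b q0 r0} (X : CA C a b q0 r0) {q r : ℤ} (hq : q ≠ q0)
    (hr : r ≠ r0) {y1 y2 g k : O} {y : ℝ} {p : ℤ} {s2 : S}
    (h1 : C none y1 (some ⟨a, q⟩) (some ⟨b, r0⟩)) (h2 : C none y2 (some ⟨a, q0⟩) (some ⟨b, r⟩))
    (m1 : m y1 s2) (m2 : m y2 s2) (hs : C none (some ⟨y, p⟩) g k)
    (hgk : (g = some ⟨a, q⟩ ∧ k = none) ∨ (g = none ∧ k = some ⟨b, r⟩)) :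
    C none (some ⟨y, s2 y⟩) (some ⟨a, q⟩) (some ⟨b, r⟩) := by
  refine X.h.line1 X.n (fun s1 => ?_)
  obtain ⟨u1, u2, u3, u4, hu, n1, n2, n3, n4⟩ := X.h.ex s1 s2 (fun _ => q) (fun _ => r)
  have e4 : u4 = some ⟨b, r⟩ := by
    rcases X.h.sp _ _ _ _ _ _ _ _ hu h1 with e | e | e | e | ⟨e1, e2, e3, e4⟩
    · simp at e
    · exact absurd e (notsepO n2 m1)
    · exact absurd e (notsepO n3 (by simp))
    · exact (sep_some e n4).1
    · subst e4; simp at n4; exact absurd n4 hr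
  have e3 : u3 = some ⟨a, q⟩ := by
    rcases X.h.sp _ _ _ _ _ _ _ _ hu h2 with e | e | e | e | ⟨e1, e2, e3, e4⟩
    · simp at e
    · exact absurd e (notsepO n2 m2)
    · exact (sep_some e n3).1
    · exact absurd e (notsepO n4 (by simp))
    · subst e3; simp at n3; exact absurd n3 hq
  subst e3 e4
  have e2 : u2 = some ⟨y, s2 y⟩ := by
    rcases hgk with ⟨rfl, rfl⟩ | ⟨rfl, rfl⟩ <;>
    · have := X.h.sp _ _ _ _ _ _ _ _ hu hs
      simp only [sepO_none_left, sepO_none_right, sepO_irrefl, reduceCtorEq, and_false, false_and,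
        or_false, false_or] at this
      exact (sep_some this n2).1
  subst e2
  exact ⟨u1, hu, n1⟩

theorem CA.fin2 {C : O → O → O → O → Prop} {a b q0 r0} (X : CA C a b q0 r0)
    (h0 : ¬ C none none none none) {y : ℝ}
    (hQ : ∀ q, C none none (some ⟨a, q⟩) (some ⟨b, r0⟩) ∨ Str2 C a b r0 q y)
    (hR : ∀ r, C none none (some ⟨a, q0⟩) (some ⟨b, r⟩) ∨
      Str2 (fun x y z w => C x y w z) b a q0 r y) : False := by
  have H : ∀ s2 s3 s4, ∃ u2 u3 u4, C none u2 u3 u4 ∧ m u2 s2 ∧ m u3 s3 ∧ m u4 s4 := by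
    intro s2 s3 s4
    obtain ⟨q, hqe⟩ : ∃ q, s3 a = q := ⟨_, rfl⟩
    obtain ⟨r, hre⟩ : ∃ r, s4 b = r := ⟨_, rfl⟩
    by_cases k1 : C none (some ⟨y, s2 y⟩) (some ⟨a, q⟩) none
    · exact ⟨_, _, _, k1, by simp, by simp [hqe], by simp⟩
    by_cases k2 : C none (some ⟨y, s2 y⟩) none (some ⟨b, r⟩)
    · exact ⟨_, _, _, k2, by simp, by simp, by simp [hre]⟩
    have y1 : ∃ y1, C none y1 (some ⟨a, q⟩) (some ⟨b, r0⟩) ∧ m y1 s2 := by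
      rcases hQ q with h | h
      · exact ⟨_, h, by simp⟩
      · exact ⟨_, (h.1 (s2 y)).resolve_left k1, by simp⟩
    have y2 : ∃ y2, C none y2 (some ⟨a, q0⟩) (some ⟨b, r⟩) ∧ m y2 s2 := by
      rcases hR r with h | h
      · exact ⟨_, h, by simp⟩
      · exact ⟨_, (h.1 (s2 y)).resolve_left k2, by simp⟩
    obtain ⟨y1, hy1, my1⟩ := y1
    obtain ⟨y2, hy2, my2⟩ := y2
    by_cases hq : q = q0
    · subst hq
      exact ⟨_, _, _, hy2, my2, by simp [hqe], by simp [hre]⟩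
    by_cases hr : r = r0
    · subst hr
      exact ⟨_, _, _, hy1, my1, by simp [hqe], by simp [hre]⟩
    rcases hQ q with g1 | ⟨-, p, hp⟩
    · rcases hR r with g2 | ⟨-, p, hp⟩
      · have : C none none (some ⟨a, q⟩) (some ⟨b, r⟩) := by
          refine X.h.plane12 X.n (fun s1 s2 => ?_)
          obtain ⟨u1, u2, u3, u4, hu, n1, n2, n3, n4⟩ := X.h.ex s1 s2 (fun _ => q) (fun _ => r)
          have e4 : u4 = some ⟨b, r⟩ := by
            rcases X.h.sp _ _ _ _ _ _ _ _ hu g1 with e | e | e | e | ⟨e1, e2, e3, e4⟩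
            · simp at e
            · simp at e
            · exact absurd e (notsepO n3 (by simp))
            · exact (sep_some e n4).1
            · subst e4; simp at n4; exact absurd n4 hr
          have e3 : u3 = some ⟨a, q⟩ := by
            rcases X.h.sp _ _ _ _ _ _ _ _ hu g2 with e | e | e | e | ⟨e1, e2, e3, e4⟩
            · simp at e
            · simp at e
            · exact (sep_some e n3).1
            · exact absurd e (notsepO n4 (by simp))
            · subst e3; simp at n3; exact absurd n3 hq
          subst e3 e4
          exact ⟨_, _, hu, n1, n2⟩
        exact ⟨_, _, _, this, by simp, by simp [hqe], by simp [hre]⟩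
      · exact ⟨_, _, _, X.fill hq hr hy1 hy2 my1 my2 hp (Or.inr ⟨rfl, rfl⟩), by simp,
          by simp [hqe], by simp [hre]⟩
    · exact ⟨_, _, _, X.fill hq hr hy1 hy2 my1 my2 hp (Or.inl ⟨rfl, rfl⟩), by simp,
          by simp [hqe], by simp [hre]⟩
  apply X.ng
  apply GoodC.of_pm (Equiv.swap 0 3)
  apply GoodC.cor
  refine secTil (X.h.pm _) (X.n.pm _) (z := none) (fun s1 s2 s3 => ?_) h0
  obtain ⟨u2, u3, u4, hu, m2, m3, m4⟩ := H s2 s3 s1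
  exact ⟨u4, u2, u3, hu, m4, m2, m3⟩

theorem CA.fin1 {C : O → O → O → O → Prop} {a b q0 r0} (X : CA C a b q0 r0)
    (h0 : ¬ C none none none none) {y : ℝ} {q r : ℤ}
    (hQ : ¬ C none none (some ⟨a, q⟩) (some ⟨b, r0⟩))
    (hR : ¬ C none none (some ⟨a, q0⟩) (some ⟨b, r⟩))
    (hy : Str2 C a b r0 q y) : False := by
  have hr : ∀ r, C none none (some ⟨a, q0⟩) (some ⟨b, r⟩) ∨
      Str2 (fun x y z w => C x y w z) b a q0 r y := by
    intro r'
    by_cases h : C none none (some ⟨a, q0⟩) (some ⟨b, r'⟩)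
    · exact Or.inl h
    · exact Or.inr (X.agree hQ h hy)
  refine X.fin2 h0 (y := y) (fun q' => ?_) hr
  by_cases h : C none none (some ⟨a, q'⟩) (some ⟨b, r0⟩)
  · exact Or.inl h
  · exact Or.inr (X.sw34.agree hR h ((hr r).resolve_left hR))

theorem caseA {C : O → O → O → O → Prop} (h : Til4 C) (hn : NC4 C)
    (h0 : ¬ C none none none none) {x y : P} (w : C none none (some x) (some y)) : GoodC C := by
  by_contra hg
  obtain ⟨a, q0⟩ := x
  obtain ⟨b, r0⟩ := y
  have X : CA C a b q0 r0 := ⟨h, hn, w, hg⟩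
  obtain ⟨q, hQ⟩ := hn.c3 none none (some ⟨b, r0⟩) a
  obtain ⟨r, hR⟩ := hn.c4 none none (some ⟨a, q0⟩) b
  rcases X.lemA2 hQ hR with ⟨y, hy⟩ | ⟨y, hy⟩
  · exact X.fin1 h0 hQ hR hy
  · exact X.sw12.fin1 h0 hQ hR hy

structure Bad (C : O → O → O → O → Prop) : Prop where
  h : Til4 C
  n : NC4 C
  z : ¬ C none none none none
  ng : ¬ GoodC C

theorem Bad.pm {C : O → O → O → O → Prop} (X : Bad C) (π : Equiv.Perm (Fin 4)) :
    Bad (pm π C) := by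
  refine ⟨X.h.pm π, X.n.pm π, ?_, fun h => X.ng (h.of_pm)⟩
  intro hc
  apply X.z
  have : ∀ i : Fin 4, (![none, none, none, none] : Fin 4 → O) i = none := by
    intro i; fin_cases i <;> rfl
  simpa only [Kel.pm, this] using hc

theorem Bad.t3 {C : O → O → O → O → Prop} (X : Bad C) (z : O) : ¬ C none none none z :=
  fun hz => X.ng (GoodC.cor (three_star X.h X.n X.z hz))

theorem Bad.t2 {C : O → O → O → O → Prop} (X : Bad C) (y z : O) : ¬ C none none y z := by
  intro hz
  rcases z with _ | z
  · exact (X.pm (Equiv.swap 2 3)).t3 y hz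
  rcases y with _ | y
  · exact X.t3 _ hz
  exact X.ng (caseA X.h X.n X.z hz)

theorem Bad.t1 {C : O → O → O → O → Prop} (X : Bad C) (x y z : O) : ¬ C x y z none := by
  intro hw
  have k : ∀ D, Bad D → ∀ y z, ¬ D none y z none := fun D Y y z h =>
    (Y.pm (Equiv.swap 1 3)).t2 z y h
  have k2 : ∀ x z, ¬ C x none z none := fun x z h => (X.pm (Equiv.swap 0 3)).t2 z x h
  have k3 : ∀ x y, ¬ C x y none none := fun x y h => k _ (X.pm (Equiv.swap 0 2)) y x h
  have one : ∀ c1 c2 c3, C c1 c2 c3 none → c1 ≠ none ∧ c2 ≠ none ∧ c3 ≠ none := by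
    refine fun c1 c2 c3 hc => ⟨?_, ?_, ?_⟩
    · rintro rfl; exact k _ X _ _ hc
    · rintro rfl; exact k2 _ _ hc
    · rintro rfl; exact k3 _ _ hc
  rcases caseB X.h X.n X.z one hw with h | h
  · exact X.ng (GoodC.cor h)
  · exact X.ng (GoodC.rig h)

theorem L4 {C : O → O → O → O → Prop} (h : Til4 C) (hn : NC4 C)
    (h0 : ¬ C none none none none) : GoodC C := by
  by_contra hg
  have X : Bad C := ⟨h, hn, h0, hg⟩
  have w4 : ∀ x y z, ¬ C x y z none := X.t1
  have w1 : ∀ x y z, ¬ C none x y z := fun x y z h => (X.pm (Equiv.swap 0 3)).t1 z x y h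
  have w2 : ∀ x y z, ¬ C x none y z := fun x y z h => (X.pm (Equiv.swap 1 3)).t1 x z y h
  have w3 : ∀ x y z, ¬ C x y none z := fun x y z h => (X.pm (Equiv.swap 2 3)).t1 x y z h
  refine PP4 (fun x => C (some (x 0)) (some (x 1)) (some (x 2)) (some (x 3)))
    ⟨fun σ => ?_, fun x y hx hy => ?_⟩ ?_
  · obtain ⟨u1, u2, u3, u4, hu, m1, m2, m3, m4⟩ := h.ex (σ 0) (σ 1) (σ 2) (σ 3)
    rcases u1 with _ | u1
    · exact absurd hu (w1 _ _ _)
    rcases u2 with _ | u2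
    · exact absurd hu (w2 _ _ _)
    rcases u3 with _ | u3
    · exact absurd hu (w3 _ _ _)
    rcases u4 with _ | u4
    · exact absurd hu (w4 _ _ _)
    refine ⟨![u1, u2, u3, u4], hu, fun i => ?_⟩
    fin_cases i
    · simpa using m1
    · simpa using m2
    · simpa using m3
    · simpa using m4
  · rcases h.sp _ _ _ _ _ _ _ _ hx hy with e | e | e | e | ⟨e1, e2, e3, e4⟩
    · exact Or.inr ⟨0, by simpa using e⟩
    · exact Or.inr ⟨1, by simpa using e⟩
    · exact Or.inr ⟨2, by simpa using e⟩
    · exact Or.inr ⟨3, by simpa using e⟩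
    · left; funext i
      simp only [Option.some.injEq] at e1 e2 e3 e4
      fin_cases i
      · exact e1
      · exact e2
      · exact e3
      · exact e4
  · intro x i l
    fin_cases i
    · obtain ⟨a, ha⟩ := hn.c1 (some (x 1)) (some (x 2)) (some (x 3)) l
      exact ⟨a, by simpa using ha⟩
    · obtain ⟨a, ha⟩ := hn.c2 (some (x 0)) (some (x 2)) (some (x 3)) l
      exact ⟨a, by simpa using ha⟩
    · obtain ⟨a, ha⟩ := hn.c3 (some (x 0)) (some (x 1)) (some (x 3)) l
      exact ⟨a, by simpa using ha⟩
    · obtain ⟨a, ha⟩ := hn.c4 (some (x 0)) (some (x 1)) (some (x 2)) l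
      exact ⟨a, by simpa using ha⟩

end Kel

set_option linter.unusedVariables false
set_option linter.unusedSimpArgs false
namespace Kel
open Pce

structure T6 (T : P → P → P → P → P → P → Prop) : Prop where
  ex : ∀ s1 s2 s3 s4 s5 s6, ∃ x1 x2 x3 x4 x5 x6, T x1 x2 x3 x4 x5 x6 ∧ m x1 s1 ∧ m x2 s2 ∧ m x3 s3 ∧
    m x4 s4 ∧ m x5 s5 ∧ m x6 s6
  sp : ∀ x1 x2 x3 x4 x5 x6 y1 y2 y3 y4 y5 y6, T x1 x2 x3 x4 x5 x6 → T y1 y2 y3 y4 y5 y6 →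
    sep x1 y1 ∨ sep x2 y2 ∨ sep x3 y3 ∨ sep x4 y4 ∨ sep x5 y5 ∨ sep x6 y6 ∨
      (x1 = y1 ∧ x2 = y2 ∧ x3 = y3 ∧ x4 = y4 ∧ x5 = y5 ∧ x6 = y6)
  c1 : ∀ x2 x3 x4 x5 x6 l, ∃ p, ¬ T ⟨l, p⟩ x2 x3 x4 x5 x6
  c2 : ∀ x2 x3 x4 x5 x6 l, ∃ p, ¬ T x2 ⟨l, p⟩ x3 x4 x5 x6
  c3 : ∀ x2 x3 x4 x5 x6 l, ∃ p, ¬ T x2 x3 ⟨l, p⟩ x4 x5 x6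
  c4 : ∀ x2 x3 x4 x5 x6 l, ∃ p, ¬ T x2 x3 x4 ⟨l, p⟩ x5 x6
  c5 : ∀ x2 x3 x4 x5 x6 l, ∃ p, ¬ T x2 x3 x4 x5 ⟨l, p⟩ x6
  c6 : ∀ x2 x3 x4 x5 x6 l, ∃ p, ¬ T x2 x3 x4 x5 x6 ⟨l, p⟩

/-- rotate the first triple -/
theorem T6.rot {T : P → P → P → P → P → P → Prop} (h : T6 T) :
    T6 (fun x y z a b c => T y z x a b c) := by
  refine ⟨fun s1 s2 s3 s4 s5 s6 => ?_, ?_, fun _ _ _ _ _ l => h.c3 _ _ _ _ _ l,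
    fun _ _ _ _ _ l => h.c1 _ _ _ _ _ l, fun _ _ _ _ _ l => h.c2 _ _ _ _ _ l,
    fun _ _ _ _ _ l => h.c4 _ _ _ _ _ l, fun _ _ _ _ _ l => h.c5 _ _ _ _ _ l,
    fun _ _ _ _ _ l => h.c6 _ _ _ _ _ l⟩
  · obtain ⟨x1, x2, x3, x4, x5, x6, hx, m1, m2, m3, m4, m5, m6⟩ := h.ex s2 s3 s1 s4 s5 s6
    exact ⟨x3, x1, x2, x4, x5, x6, hx, m3, m1, m2, m4, m5, m6⟩
  · intro x1 x2 x3 x4 x5 x6 y1 y2 y3 y4 y5 y6 hx hy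
    have := h.sp _ _ _ _ _ _ _ _ _ _ _ _ hx hy
    tauto

/-- exchange the triples -/
theorem T6.sw {T : P → P → P → P → P → P → Prop} (h : T6 T) :
    T6 (fun x y z a b c => T a b c x y z) := by
  refine ⟨fun s1 s2 s3 s4 s5 s6 => ?_, ?_, fun _ _ _ _ _ l => h.c4 _ _ _ _ _ l,
    fun _ _ _ _ _ l => h.c5 _ _ _ _ _ l, fun _ _ _ _ _ l => h.c6 _ _ _ _ _ l,
    fun _ _ _ _ _ l => h.c1 _ _ _ _ _ l, fun _ _ _ _ _ l => h.c2 _ _ _ _ _ l,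
    fun _ _ _ _ _ l => h.c3 _ _ _ _ _ l⟩
  · obtain ⟨x1, x2, x3, x4, x5, x6, hx, m1, m2, m3, m4, m5, m6⟩ := h.ex s4 s5 s6 s1 s2 s3
    exact ⟨x4, x5, x6, x1, x2, x3, hx, m4, m5, m6, m1, m2, m3⟩
  · intro x1 x2 x3 x4 x5 x6 y1 y2 y3 y4 y5 y6 hx hy
    have := h.sp _ _ _ _ _ _ _ _ _ _ _ _ hx hy
    tauto

theorem rod3 {T : P → P → P → P → P → P → Prop} (h : T6 T) {B1 B2 B3 k1 k2 k3 : P}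
    {a b c t1 t2 t3} (hc : CAt (fun x y z => T x y z B1 B2 B3) k1 k2 k3 a b c t1 t2 t3)
    {q r : ℤ} (hq : t2 q) (hr : ¬ t3 r) :
    ∃ p1, p1 ≠ k1.a ∧ ∃ g1 g2 g3 s1 s2 s3,
      CAt (fun x y z => T ⟨k1.l, p1⟩ ⟨b, q⟩ ⟨c, r⟩ x y z) B1 B2 B3 g1 g2 g3 s1 s2 s3 := by
  obtain ⟨p1, hp1⟩ := h.c1 ⟨b, q⟩ ⟨c, r⟩ B1 B2 B3 k1.l
  have hk := hc.r1 q r hq hr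
  have hne : p1 ≠ k1.a := by
    rintro rfl; exact hp1 hk
  refine ⟨p1, hne, ?_⟩
  refine L3loc ?_ ?_ (fun _ _ l => h.c4 _ _ _ _ _ l) (fun _ _ l => h.c5 _ _ _ _ _ l)
    (fun _ _ l => h.c6 _ _ _ _ _ l) hp1
  · intro s4 s5 s6 n4 n5 n6
    obtain ⟨x1, x2, x3, x4, x5, x6, hx, m1, m2, m3, m4, m5, m6⟩ :=
      h.ex (fun _ => p1) (fun _ => q) (fun _ => r) s4 s5 s6
    have f4 : ¬ sep x4 B1 := notsepP m4 n4
    have f5 : ¬ sep x5 B2 := notsepP m5 n5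
    have f6 : ¬ sep x6 B3 := notsepP m6 n6
    have e1 : x1 = ⟨k1.l, p1⟩ := by
      rcases h.sp _ _ _ _ _ _ _ _ _ _ _ _ hx hk with e | e | e | e | e | e | e
      · exact (sep_someP e m1).1
      · exact absurd e (notsepP m2 (by simp))
      · exact absurd e (notsepP m3 (by simp))
      · exact absurd e f4
      · exact absurd e f5
      · exact absurd e f6
      · exfalso
        have := e.1
        subst this
        exact hne m1
    subst e1
    obtain ⟨p, hp⟩ := hc.n1
    obtain ⟨p', hp'⟩ := hc.n1'
    obtain ⟨q', hq'⟩ := hc.n2'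
    obtain ⟨r', hr'⟩ := hc.n3
    have e3 : x3 = ⟨c, r⟩ := by
      rcases h.sp _ _ _ _ _ _ _ _ _ _ _ _ hx (hc.b1 p q r' hp hq hr') with e | e | e | e | e | e | e
      · exact absurd e.1.symm hc.l1
      · exact absurd e (notsepP m2 (by simp))
      · exact (sep_someP e m3).1
      · exact absurd e f4
      · exact absurd e f5
      · exact absurd e f6
      · exact absurd (congrArg P.l e.1).symm hc.l1
    have e2 : x2 = ⟨b, q⟩ := by
      rcases h.sp _ _ _ _ _ _ _ _ _ _ _ _ hx (hc.b0 p' q' r hp' hq' hr) with e | e | e | e | e | e | e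
      · exact absurd e.1.symm hc.l1
      · exact (sep_someP e m2).1
      · exact absurd e (notsepP m3 (by simp))
      · exact absurd e f4
      · exact absurd e f5
      · exact absurd e f6
      · exact absurd (congrArg P.l e.1).symm hc.l1
    subst e2 e3
    exact ⟨_, _, _, hx, m4, m5, m6⟩
  · intro x1 x2 x3 y1 y2 y3 hx hy
    have := h.sp _ _ _ _ _ _ _ _ _ _ _ _ hx hy
    simpa using this

def Cov (F : P → P → P → Prop) (s1 s2 s3 : S) : Prop := ∃ x1 x2 x3, F x1 x2 x3 ∧ m x1 s1 ∧ m x2 s2 ∧ m x3 s3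

theorem CAt.cov {F : P → P → P → Prop} {k1 k2 k3 : P} {a b c t1 t2 t3}
    (h : CAt F k1 k2 k3 a b c t1 t2 t3) {s1 s2 s3 : S}
    (h3 : t1 (s1 a) → ¬ t2 (s2 b) → m k3 s3) (h1 : t2 (s2 b) → ¬ t3 (s3 c) → m k1 s1)
    (h2 : t3 (s3 c) → ¬ t1 (s1 a) → m k2 s2) : Cov F s1 s2 s3 := by
  by_cases f1 : t1 (s1 a)
  · by_cases f2 : t2 (s2 b)
    · by_cases f3 : t3 (s3 c)
      · exact ⟨_, _, _, h.b1 _ _ _ f1 f2 f3, rfl, rfl, rfl⟩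
      · exact ⟨_, _, _, h.r1 _ _ f2 f3, h1 f2 f3, rfl, rfl⟩
    · exact ⟨_, _, _, h.r3 _ _ f1 f2, rfl, rfl, h3 f1 f2⟩
  · by_cases f3 : t3 (s3 c)
    · exact ⟨_, _, _, h.r2 _ _ f3 f1, rfl, h2 f3 f1, rfl⟩
    · by_cases f2 : t2 (s2 b)
      · exact ⟨_, _, _, h.r1 _ _ f2 f3, h1 f2 f3, rfl, rfl⟩
      · exact ⟨_, _, _, h.b0 _ _ _ f1 f2 f3, rfl, rfl, rfl⟩

theorem step2core {F : P → P → P → Prop} {k1 k2 k3 : P} {a b c t1 t2 t3}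
    (h : CAt F k1 k2 k3 a b c t1 t2 t3) {p1 q r : ℤ} (hq : t2 q) (hr : ¬ t3 r)
    (G : Fin 3 → P → P → P → Prop)
    (hG : ∀ k, ∃ d1 d2 d3 e1 e2 e3, CAt (G k) ⟨k1.l, p1⟩ ⟨b, q⟩ ⟨c, r⟩ d1 d2 d3 e1 e2 e3)
    (Z : ∀ s1 s2 s3, Cov F s1 s2 s3 → (∀ k, Cov (G k) s1 s2 s3) → False) : False := by
  choose d1 d2 d3 e1 e2 e3 hC using hG
  have third : ∀ k l : Fin 3, k ≠ l → ∃ n, ∀ j, j = k ∨ j = l ∨ j = n := by decide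
  have H1 : ∀ s3 : S, s3 c = r → ∀ k l, k ≠ l → e3 k (s3 (d3 k)) → e3 l (s3 (d3 l)) → False := by
    intro s3 hs3 k l hkl hk hl
    obtain ⟨n, hn⟩ := third k l hkl
    obtain ⟨v, hv⟩ := (hC n).n2'
    have hd : d2 n ≠ b := (hC n).l2
    refine Z (fun _ => k1.a) (Function.update (fun _ => q) (d2 n) v) s3
      ⟨_, _, _, h.r1 q r hq hr, rfl, ?_, hs3⟩ (fun j => (hC j).cov ?_ ?_ ?_)
    · simp [Function.update_of_ne hd.symm]
    · intro _ _; exact hs3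
    · intro g1 g2
      exfalso
      rcases hn j with rfl | rfl | rfl
      · exact g2 hk
      · exact g2 hl
      · simp at g1; exact hv g1
    · intro _ _
      simp [Function.update_of_ne hd.symm]
  have H2 : ∀ s1 : S, s1 k1.l = p1 → ¬ t1 (s1 a) → ∀ k, ¬ e1 k (s1 (d1 k)) := by
    intro s1 hs1 ht k hk
    obtain ⟨v, hv⟩ := (hC k).n3
    have hd : d3 k ≠ c := (hC k).l3
    obtain ⟨q', hq'⟩ := h.n2'
    have hs3 : Function.update (fun _ => r) (d3 k) v c = r := by
      simp [Function.update_of_ne hd.symm]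
    refine Z s1 (fun _ => q') (Function.update (fun _ => r) (d3 k) v)
      ⟨_, _, _, h.b0 _ q' r ht hq' hr, rfl, rfl, hs3⟩ (fun j => (hC j).cov ?_ ?_ ?_)
    · intro _ _; exact hs3
    · intro _ _; exact hs1
    · intro g1 g2
      exfalso
      by_cases hj : j = k
      · subst hj; exact g2 hk
      · exact H1 _ hs3 j k hj g1 (by simpa using hv)
  obtain ⟨p', hp'⟩ := h.n1'
  obtain ⟨r', hr'⟩ := h.n3
  have ha : Function.update (fun _ => p1) a p' k1.l = p1 := by
    simp [Function.update_of_ne h.l1.symm]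
  have ha' : Function.update (fun _ => p1) a p' a = p' := by simp
  have hb : Function.update (fun _ => k2.a) b q k2.l = k2.a := by
    simp [Function.update_of_ne h.l2.symm]
  refine Z (Function.update (fun _ => p1) a p') (Function.update (fun _ => k2.a) b q) (fun _ => r')
    ⟨_, _, _, h.r2 p' r' hr' hp', ha', hb, rfl⟩ (fun j => (hC j).cov ?_ ?_ ?_)
  · intro g1
    exact absurd g1 (H2 _ ha (by rw [ha']; exact hp') j)
  · intro _ _; exact ha
  · intro _ _; simp

theorem Zlem {T : P → P → P → P → P → P → Prop} (h : T6 T) {B1 B2 B3 : P}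
    {g1 g2 g3 : ℝ} (l1 : g1 ≠ B1.l) (l2 : g2 ≠ B2.l) (l3 : g3 ≠ B3.l)
    {u1 u2 u3 i1 i2 i3 o1 o2 o3 : ℤ} (n1 : o1 ≠ i1) (n2 : o2 ≠ i2) (n3 : o3 ≠ i3) {s1 s2 s3 : S}
    (hB : Cov (fun x y z => T x y z B1 B2 B3) s1 s2 s3)
    (h1 : Cov (fun x y z => T x y z ⟨B1.l, u1⟩ ⟨g2, i2⟩ ⟨g3, o3⟩) s1 s2 s3)
    (h2 : Cov (fun x y z => T x y z ⟨g1, o1⟩ ⟨B2.l, u2⟩ ⟨g3, i3⟩) s1 s2 s3)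
    (h3 : Cov (fun x y z => T x y z ⟨g1, i1⟩ ⟨g2, o2⟩ ⟨B3.l, u3⟩) s1 s2 s3) : False := by
  obtain ⟨x1, x2, x3, x4, x5, x6, hx, m1, m2, m3, m4, m5, m6⟩ :=
    h.ex s1 s2 s3 (Function.update (fun _ => o1) B1.l u1) (Function.update (fun _ => o2) B2.l u2)
      (Function.update (fun _ => o3) B3.l u3)
  have a1 : m (⟨g1, o1⟩ : P) (Function.update (fun _ => o1) B1.l u1) := by
    simp [Function.update_of_ne l1]
  have a2 : m (⟨g2, o2⟩ : P) (Function.update (fun _ => o2) B2.l u2) := by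
    simp [Function.update_of_ne l2]
  have a3 : m (⟨g3, o3⟩ : P) (Function.update (fun _ => o3) B3.l u3) := by
    simp [Function.update_of_ne l3]
  have b1 : m (⟨B1.l, u1⟩ : P) (Function.update (fun _ => o1) B1.l u1) := by simp
  have b2 : m (⟨B2.l, u2⟩ : P) (Function.update (fun _ => o2) B2.l u2) := by simp
  have b3 : m (⟨B3.l, u3⟩ : P) (Function.update (fun _ => o3) B3.l u3) := by simp
  simp only [mP] at a1 a2 a3
  have e5 : x5 = ⟨g2, o2⟩ := by
    obtain ⟨y1, y2, y3, hy, k1, k2, k3⟩ := h1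
    rcases h.sp _ _ _ _ _ _ _ _ _ _ _ _ hx hy with e | e | e | e | e | e | e
    · exact absurd e (notsepP m1 k1)
    · exact absurd e (notsepP m2 k2)
    · exact absurd e (notsepP m3 k3)
    · exact absurd e (notsepP m4 b1)
    · have := (sep_someP e m5).1
      simp only [a2] at this
      exact this
    · exact absurd e (notsepP m6 a3)
    · have := e.2.2.2.2.1
      subst this
      simp only [mP, a2] at m5
      exact absurd m5 n2
  have e6 : x6 = ⟨g3, o3⟩ := by
    obtain ⟨y1, y2, y3, hy, k1, k2, k3⟩ := h2
    rcases h.sp _ _ _ _ _ _ _ _ _ _ _ _ hx hy with e | e | e | e | e | e | e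
    · exact absurd e (notsepP m1 k1)
    · exact absurd e (notsepP m2 k2)
    · exact absurd e (notsepP m3 k3)
    · exact absurd e (notsepP m4 a1)
    · exact absurd e (notsepP m5 b2)
    · have := (sep_someP e m6).1
      simp only [a3] at this
      exact this
    · have := e.2.2.2.2.2
      subst this
      simp only [mP, a3] at m6
      exact absurd m6 n3
  have e4 : x4 = ⟨g1, o1⟩ := by
    obtain ⟨y1, y2, y3, hy, k1, k2, k3⟩ := h3
    rcases h.sp _ _ _ _ _ _ _ _ _ _ _ _ hx hy with e | e | e | e | e | e | e
    · exact absurd e (notsepP m1 k1)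
    · exact absurd e (notsepP m2 k2)
    · exact absurd e (notsepP m3 k3)
    · have := (sep_someP e m4).1
      simp only [a1] at this
      exact this
    · exact absurd e (notsepP m5 a2)
    · exact absurd e (notsepP m6 b3)
    · have := e.2.2.2.1
      subst this
      simp only [mP, a1] at m4
      exact absurd m4 n1
  subst e4 e5 e6
  obtain ⟨y1, y2, y3, hy, k1, k2, k3⟩ := hB
  rcases h.sp _ _ _ _ _ _ _ _ _ _ _ _ hx hy with e | e | e | e | e | e | e
  · exact absurd e (notsepP m1 k1)
  · exact absurd e (notsepP m2 k2)
  · exact absurd e (notsepP m3 k3)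
  · exact l1 e.1
  · exact l2 e.1
  · exact l3 e.1
  · exact l1 (congrArg P.l e.2.2.2.1)

theorem step2 {T : P → P → P → P → P → P → Prop} (h : T6 T) {B1 B2 B3 k1 k2 k3 : P}
    {a b c t1 t2 t3} (hc : CAt (fun x y z => T x y z B1 B2 B3) k1 k2 k3 a b c t1 t2 t3) : False := by
  obtain ⟨q, hq⟩ := hc.n2
  obtain ⟨r, hr⟩ := hc.n3'
  obtain ⟨p1, -, g1, g2, g3, f1, f2, f3, hg⟩ := rod3 h hc hq hr
  obtain ⟨i1, hi1⟩ := hg.n1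
  obtain ⟨i2, hi2⟩ := hg.n2
  obtain ⟨i3, hi3⟩ := hg.n3
  obtain ⟨o1, ho1⟩ := hg.n1'
  obtain ⟨o2, ho2⟩ := hg.n2'
  obtain ⟨o3, ho3⟩ := hg.n3'
  obtain ⟨u1, -, w1⟩ := rod3 (T := fun x y z a b c => T a b c x y z) h.sw hg hi2 ho3
  obtain ⟨u3, -, w3⟩ := rod3 (T := fun x y z a b c => T a b c y z x) h.sw.rot hg.rot hi1 ho2
  obtain ⟨u2, -, w2⟩ := rod3 (T := fun x y z a b c => T a b c z x y) h.sw.rot.rot hg.rot.rot hi3 ho1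
  refine step2core hc (p1 := p1) hq hr
    ![fun x y z => T x y z ⟨B1.l, u1⟩ ⟨g2, i2⟩ ⟨g3, o3⟩,
      fun x y z => T x y z ⟨g1, o1⟩ ⟨B2.l, u2⟩ ⟨g3, i3⟩,
      fun x y z => T x y z ⟨g1, i1⟩ ⟨g2, o2⟩ ⟨B3.l, u3⟩] ?_ ?_
  · intro k
    fin_cases k
    · exact w1
    · exact w2
    · exact w3
  · intro s1 s2 s3 hF hG
    refine Zlem h hg.l1 hg.l2 hg.l3 (i1 := i1) (i2 := i2) (i3 := i3) (o1 := o1) (o2 := o2) (o3 := o3)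
      ?_ ?_ ?_ hF (hG 0) (hG 1) (hG 2)
    · rintro rfl; exact ho1 hi1
    · rintro rfl; exact ho2 hi2
    · rintro rfl; exact ho3 hi3

theorem Crn.mono {C D : O → O → O → Prop} {a b c t1 t2 t3} (h : Crn C a b c t1 t2 t3)
    (H : ∀ x y z, C x y z → D x y z) : Crn D a b c t1 t2 t3 :=
  ⟨h.n1, h.n1', h.n2, h.n2', h.n3, h.n3', fun _ _ _ a b c => H _ _ _ (h.b1 _ _ _ a b c),
    fun _ _ _ a b c => H _ _ _ (h.b0 _ _ _ a b c), fun _ _ a b => H _ _ _ (h.r3 _ _ a b),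
    fun _ _ a b => H _ _ _ (h.r1 _ _ a b), fun _ _ a b => H _ _ _ (h.r2 _ _ a b)⟩

theorem vec4 {α : Type} (f : Fin 4 → α) (j : Fin 4) : ![f 0, f 1, f 2, f 3] j = f j := by
  fin_cases j <;> rfl

theorem vec4' {α β : Type} (f : α → β) (a b c d : α) (j : Fin 4) :
    ![f a, f b, f c, f d] j = f (![a, b, c, d] j) := by
  fin_cases j <;> rfl

def cur6 (T : (Fin 6 → P) → Prop) (π : Equiv.Perm (Fin 4)) (x1 x2 x3 x4 y1 y2 : P) : Prop :=
  T (Fin.cons y2 (Fin.cons y1 (fun i : Fin 4 => (![x1, x2, x3, x4] : Fin 4 → P) (π i))) : Fin 6 → P)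

theorem upd4 (x1 x2 x3 x4 v : P) : Function.update ![x1, x2, x3, x4] 0 v = ![v, x2, x3, x4] ∧
    Function.update ![x1, x2, x3, x4] 1 v = ![x1, v, x3, x4] ∧
    Function.update ![x1, x2, x3, x4] 2 v = ![x1, x2, v, x4] ∧
    Function.update ![x1, x2, x3, x4] 3 v = ![x1, x2, x3, v] := by
  refine ⟨?_, ?_, ?_, ?_⟩ <;> (funext i; fin_cases i <;> rfl)

theorem cur6_T6 {T : (Fin 6 → P) → Prop} (h : TilF T) (hn : NoColF T) (π : Equiv.Perm (Fin 4)) :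
    T6 (cur6 T π) := by
  have nc : ∀ (x : Fin 4 → P) (y1 y2 : P) (j : Fin 4) l, ∃ p,
      ¬ T (Fin.cons y2 (Fin.cons y1 (fun i => Function.update x j ⟨l, p⟩ (π i))) : Fin 6 → P) := by
    intro x y1 y2 j l
    exact (hn.tail2 y2 y1).perm π x j l
  refine ⟨?_, ?_, ?_, ?_, ?_, ?_, ?_, ?_⟩
  · intro s1 s2 s3 s4 s5 s6
    obtain ⟨x, hx, hm⟩ := h.1 (Fin.cons s6 (Fin.cons s5 (fun i => (![s1, s2, s3, s4] : Fin 4 → S) (π i))) : Fin 6 → S)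
    have hm' : ∀ j : Fin 4, m (x (π.symm j).succ.succ) ((![s1, s2, s3, s4] : Fin 4 → S) j) := by
      intro j
      have := hm (π.symm j).succ.succ
      simpa only [Fin.cons_succ, Equiv.apply_symm_apply] using this
    refine ⟨x (π.symm 0).succ.succ, x (π.symm 1).succ.succ, x (π.symm 2).succ.succ,
      x (π.symm 3).succ.succ, x 1, x 0, ?_, hm' 0, hm' 1, hm' 2, hm' 3, hm 1, hm 0⟩
    unfold cur6
    convert hx using 1
    funext i
    refine Fin.cases rfl (fun i => ?_) i
    refine Fin.cases rfl (fun i => ?_) i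
    simp only [Fin.cons_succ]
    rw [vec4 (fun j => x (π.symm j).succ.succ)]
    simp
  · intro x1 x2 x3 x4 x5 x6 y1 y2 y3 y4 y5 y6 hx hy
    rcases h.2 _ _ hx hy with e | ⟨i, hi⟩
    · have e' : ∀ j : Fin 4, (![x1, x2, x3, x4] : Fin 4 → P) j = (![y1, y2, y3, y4] : Fin 4 → P) j := by
        intro j
        have := congrFun e (π.symm j).succ.succ
        simpa only [Fin.cons_succ, Equiv.apply_symm_apply] using this
      right; right; right; right; right; right
      exact ⟨e' 0, e' 1, e' 2, e' 3, congrFun e 1, congrFun e 0⟩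
    · revert hi
      refine Fin.cases (fun hi => ?_) (fun i => ?_) i
      · right; right; right; right; right; left; exact hi
      refine Fin.cases (fun hi => ?_) (fun i => ?_) i
      · right; right; right; right; left; exact hi
      simp only [Fin.cons_succ]
      generalize π i = j
      intro hi
      fin_cases j
      · left; exact hi
      · right; left; exact hi
      · right; right; left; exact hi
      · right; right; right; left; exact hi
  · intro x2 x3 x4 y1 y2 l
    have := nc ![x2, x2, x3, x4] y1 y2 0 l
    simp only [(upd4 _ _ _ _ _).1] at this
    exact this
  · intro x2 x3 x4 y1 y2 l
    have := nc ![x2, x2, x3, x4] y1 y2 1 l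
    simp only [(upd4 _ _ _ _ _).2.1] at this
    exact this
  · intro x2 x3 x4 y1 y2 l
    have := nc ![x2, x3, x3, x4] y1 y2 2 l
    simp only [(upd4 _ _ _ _ _).2.2.1] at this
    exact this
  · intro x2 x3 x4 y1 y2 l
    have := nc ![x2, x3, x4, x4] y1 y2 3 l
    simp only [(upd4 _ _ _ _ _).2.2.2] at this
    exact this
  · intro x1 x2 x3 x4 y2 l
    obtain ⟨p, hp⟩ := hn (Fin.cons y2 (Fin.cons y2 (fun i : Fin 4 => (![x1, x2, x3, x4] : Fin 4 → P) (π i)))) 1 l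
    refine ⟨p, fun hc => hp ?_⟩
    unfold cur6 at hc
    convert hc using 1
    funext i
    refine Fin.cases rfl (fun i => ?_) i
    refine Fin.cases rfl (fun i => ?_) i
    rfl
  · intro x1 x2 x3 x4 y1 l
    obtain ⟨p, hp⟩ := hn (Fin.cons y1 (Fin.cons y1 (fun i : Fin 4 => (![x1, x2, x3, x4] : Fin 4 → P) (π i)))) 0 l
    refine ⟨p, fun hc => hp ?_⟩
    unfold cur6 at hc
    convert hc using 1
    funext i
    refine Fin.cases rfl (fun i => ?_) i
    rfl

theorem PP6 : PP 6 := by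
  intro T0 h0 hn0
  obtain ⟨T, B2, B1, K, h, hn, hK, hloc⟩ := fact1 h0 hn0 PP5
  obtain ⟨π, hc⟩ := L4 (cur4 hloc.rel) (ncur4 ((hn.tail2 B2 B1).rel K)) (by
    intro hc
    apply hK
    convert hc.1 using 3
    funext i; fin_cases i <;> rfl)
  obtain ⟨k, hk⟩ : ∃ k : Fin 4 → P, ∀ j, k j = K (π.symm j) := ⟨_, fun _ => rfl⟩
  have h6 := cur6_T6 h hn π
  have real : ∀ u1 u2 u3 u4, pm π (fun a b c d => Rel (fun x => T (Fin.cons B2 (Fin.cons B1 x))) K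
      ![a, b, c, d]) u1 u2 u3 u4 → cur6 T π (u1.getD (k 0)) (u2.getD (k 1)) (u3.getD (k 2))
        (u4.getD (k 3)) B1 B2 ∧ (∀ p, u1 = some p → p.l ≠ (k 0).l) ∧
        (∀ p, u2 = some p → p.l ≠ (k 1).l) ∧ (∀ p, u3 = some p → p.l ≠ (k 2).l) ∧
        (∀ p, u4 = some p → p.l ≠ (k 3).l) := by
    intro u1 u2 u3 u4 hu
    have hu' : Rel (fun x => T (Fin.cons B2 (Fin.cons B1 x))) K
      (fun i => (![u1, u2, u3, u4] : Fin 4 → O) (π i)) := by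
      have e : (fun i => (![u1, u2, u3, u4] : Fin 4 → O) (π i)) = ![(![u1, u2, u3, u4] : Fin 4 → O) (π 0),
        ![u1, u2, u3, u4] (π 1), ![u1, u2, u3, u4] (π 2), ![u1, u2, u3, u4] (π 3)] := by
        funext i; fin_cases i <;> rfl
      rw [e]
      exact hu
    have hl : ∀ j p, (![u1, u2, u3, u4] : Fin 4 → O) j = some p → p.l ≠ (k j).l := by
      intro j p hp
      have := hu'.2 (π.symm j) p (by simpa only [Equiv.apply_symm_apply] using hp)
      rw [hk]; exact this
    refine ⟨?_, hl 0, hl 1, hl 2, hl 3⟩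
    have := hu'.1
    unfold cur6
    convert this using 4
    rename_i i
    dsimp only
    have e : K i = k (π i) := by rw [hk]; simp
    rw [e]
    generalize π i = j
    fin_cases j <;> rfl
  rcases hc with ⟨z, a, b, c, t1, t2, t3, hc⟩ | hr
  · refine step2 h6 (B1 := z.getD (k 3)) (B2 := B1) (B3 := B2) (k1 := k 0) (k2 := k 1) (k3 := k 2)
      (Crn.at (hc.mono ?_))
    intro x y z' hx
    obtain ⟨g1, g2, g3, g4, -⟩ := real _ _ _ _ hx
    exact ⟨g1, g2, g3, g4⟩
  · obtain ⟨w1, w2, w3, s1, s2, s3, hw, m1, m2, m3, H⟩ := hr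
    obtain ⟨hw', l1, l2, l3, -⟩ := real _ _ _ _ hw
    have mg : ∀ {w : O} {k : P} {s : S}, m w s → (∀ p, w = some p → p.l ≠ k.l) →
        m (w.getD k) (mv k s) := by
      intro w k s hm hl
      rcases w with _ | w
      · exact m_mv _ _
      · have := hl w rfl
        simp only [mO_some] at hm
        simp [mv, this, hm]
    refine rod (W := P × P × P) (Λ := S × S × S) (fun w s => m w.1 s.1 ∧ m w.2.1 s.2.1 ∧ m w.2.2 s.2.2)
      (fun w k y1 y2 => cur6 T π w.1 w.2.1 w.2.2 k y1 y2) ?_ ?_ ?_ ?_ ?_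
      (w := (w1.getD (k 0), w2.getD (k 1), w3.getD (k 2))) (k := k 3) (B1 := B1) (B2 := B2) hw'
      (lam := (mv (k 0) s1, mv (k 1) s2, mv (k 2) s3)) ⟨mg m1 l1, mg m2 l2, mg m3 l3⟩ ?_
    · intro lam s1 s2 s3
      obtain ⟨x1, x2, x3, x4, x5, x6, hx, m1, m2, m3, m4, m5, m6⟩ := h6.ex lam.1 lam.2.1 lam.2.2 s1 s2 s3
      exact ⟨(x1, x2, x3), x4, x5, x6, hx, ⟨m1, m2, m3⟩, m4, m5, m6⟩
    · rintro ⟨x1, x2, x3⟩ x4 x5 x6 ⟨y1, y2, y3⟩ y4 y5 y6 hx hy lam ⟨a1, a2, a3⟩ ⟨b1, b2, b3⟩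
      rcases h6.sp _ _ _ _ _ _ _ _ _ _ _ _ hx hy with e | e | e | e | e | e | ⟨e1, e2, e3, e4, e5, e6⟩
      · exact absurd e (notsepP a1 b1)
      · exact absurd e (notsepP a2 b2)
      · exact absurd e (notsepP a3 b3)
      · exact Or.inl e
      · exact Or.inr (Or.inl e)
      · exact Or.inr (Or.inr (Or.inl e))
      · simp only at e1 e2 e3
        subst e1 e2 e3 e4 e5 e6
        exact Or.inr (Or.inr (Or.inr ⟨rfl, rfl, rfl, rfl⟩))
    · intro w b c l; exact h6.c4 _ _ _ _ _ l
    · intro w b c l; exact h6.c5 _ _ _ _ _ l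
    · intro w b c l; exact h6.c6 _ _ _ _ _ l
    · rintro ⟨b1, b2, b3⟩ ⟨n1, n2, n3⟩ hb
      simp only at n1 n2 n3
      have f1 := rl_getD (m_mv _ _) n1
      have f2 := rl_getD (m_mv _ _) n2
      have f3 := rl_getD (m_mv _ _) n3
      have := H (rl (k 0) b1) (rl (k 1) b2) (rl (k 2) b3) (m_rl_mv n1) (m_rl_mv n2) (m_rl_mv n3) (by
        intro c1 c2 c3 v hcv hv
        obtain ⟨hr, j1, j2, j3, j4⟩ := real _ _ _ _ hcv
        by_contra hno
        push Not at hno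
        obtain ⟨v, rfl⟩ := Option.ne_none_iff_exists'.1 hv
        refine hb (c1.getD (k 0), c2.getD (k 1), c3.getD (k 2)) v hr (j4 _ rfl) ?_
        obtain ⟨σ1, a1, a1'⟩ := commonP (u := b1) (v := c1.getD (k 0)) (fun e => hno.1
          (sep_getD (fun p hp => rl_leg hp) j1 (by rw [f1]; exact e)))
        obtain ⟨σ2, a2, a2'⟩ := commonP (u := b2) (v := c2.getD (k 1)) (fun e => hno.2.1
          (sep_getD (fun p hp => rl_leg hp) j2 (by rw [f2]; exact e)))
        obtain ⟨σ3, a3, a3'⟩ := commonP (u := b3) (v := c3.getD (k 2)) (fun e => hno.2.2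
          (sep_getD (fun p hp => rl_leg hp) j3 (by rw [f3]; exact e)))
        exact ⟨(σ1, σ2, σ3), ⟨a1, a2, a3⟩, a1', a2', a3'⟩)
      obtain ⟨e1, e2, e3⟩ := this
      rw [← e1, ← e2, ← e3, f1, f2, f3]

end Kel

set_option linter.unusedVariables false
set_option linter.unusedSimpArgs false
namespace Kel

theorem one_dim {α : Type*} (Q : α → Prop) (f : α → ℝ)
    (h : ∀ z : ℝ, ∃ t, (Q t ∧ f t ≤ z ∧ z < f t + 1) ∧ ∀ u, Q u ∧ f u ≤ z ∧ z < f u + 1 → u = t)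
    (g : ℝ → ℤ) :
    ∃ t, (Q t ∧ g (Int.fract (f t)) = ⌊f t⌋) ∧ ∀ u, Q u ∧ g (Int.fract (f u)) = ⌊f u⌋ → u = t := by
  have un : ∀ t u z, Q t → Q u → f t ≤ z → z < f t + 1 → f u ≤ z → z < f u + 1 → t = u := by
    intro t u z ht hu h1 h2 h3 h4
    obtain ⟨w, -, hw⟩ := h z
    rw [hw t ⟨ht, h1, h2⟩, hw u ⟨hu, h3, h4⟩]
  have up : ∀ t, Q t → ∃ u, Q u ∧ f u = f t + 1 := by
    intro t ht
    obtain ⟨u, ⟨hu, h1, h2⟩, -⟩ := h (f t + 1)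
    refine ⟨u, hu, ?_⟩
    by_contra hne
    have hlt := lt_of_le_of_ne h1 hne
    have := un t u (f u) ht hu (by linarith) hlt le_rfl (by linarith)
    subst this
    linarith
  have dn : ∀ t, Q t → ∃ u, Q u ∧ f u = f t - 1 := by
    intro t ht
    obtain ⟨u, ⟨hu, h1, h2⟩, -⟩ := h (f t - 1)
    refine ⟨u, hu, ?_⟩
    by_contra hne
    have hlt := lt_of_le_of_ne h1 hne
    obtain ⟨v, hv, e⟩ := up u hu
    have := un v t (f t) hv ht (by linarith) (by linarith) le_rfl (by linarith)
    subst this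
    linarith
  obtain ⟨t0, ⟨ht0, -, -⟩, -⟩ := h 0
  have all : ∀ k : ℤ, ∃ u, Q u ∧ f u = f t0 + k := by
    intro k
    induction k using Int.induction_on with
    | zero => exact ⟨t0, ht0, by simp⟩
    | succ i ih =>
      obtain ⟨u, hu, e⟩ := ih
      obtain ⟨v, hv, e'⟩ := up u hu
      exact ⟨v, hv, by rw [e', e]; push_cast; ring⟩
    | pred i ih =>
      obtain ⟨u, hu, e⟩ := ih
      obtain ⟨v, hv, e'⟩ := dn u hu
      exact ⟨v, hv, by rw [e', e]; push_cast; ring⟩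
  have cos : ∀ t, Q t → ∃ k : ℤ, f t = f t0 + k := by
    intro t ht
    obtain ⟨u, hu, e⟩ := all ⌊f t - f t0⌋
    have h1 := Int.floor_le (f t - f t0)
    have h2 := Int.lt_floor_add_one (f t - f t0)
    have := un u t (f t) hu ht (by linarith) (by linarith) le_rfl (by linarith)
    subst this
    exact ⟨_, e⟩
  obtain ⟨t, ht, e⟩ := all (g (Int.fract (f t0)) - ⌊f t0⌋)
  have et : g (Int.fract (f t)) = ⌊f t⌋ := by
    rw [e, Int.fract_add_intCast, Int.floor_add_intCast]; ring
  refine ⟨t, ⟨ht, et⟩, ?_⟩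
  rintro u ⟨hu, eu⟩
  obtain ⟨k, hk⟩ := cos u hu
  have fr : Int.fract (f u) = Int.fract (f t) := by
    rw [hk, e, Int.fract_add_intCast, Int.fract_add_intCast]
  have fl : ⌊f u⌋ = ⌊f t⌋ := by rw [← eu, ← et, fr]
  have : f u = f t := by
    rw [← Int.floor_add_fract (f u), ← Int.floor_add_fract (f t), fr, fl]
  exact un u t (f u) hu ht le_rfl (by linarith) (by linarith) (by linarith)

def Okk {n : ℕ} (k : ℕ) (σ : Fin n → S) (y t : Fin n → ℝ) (i : Fin n) : Prop :=
  if i.val < k then σ i (Int.fract (t i)) = ⌊t i⌋ else t i ≤ y i ∧ y i < t i + 1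

theorem transfer {n : ℕ} (T : Set (Fin n → ℝ))
    (h : ∀ y : Fin n → ℝ, ∃ t, (t ∈ T ∧ ∀ i, t i ≤ y i ∧ y i < t i + 1) ∧
      ∀ u, (u ∈ T ∧ ∀ i, u i ≤ y i ∧ y i < u i + 1) → u = t) (k : ℕ) (hk : k ≤ n) :
    ∀ (σ : Fin n → S) (y : Fin n → ℝ), ∃ t, (t ∈ T ∧ ∀ i, Okk k σ y t i) ∧
      ∀ u, (u ∈ T ∧ ∀ i, Okk k σ y u i) → u = t := by
  induction k with
  | zero =>
    intro σ y
    simpa [Okk] using h y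
  | succ k ih =>
    intro σ y
    obtain ⟨i0, hi0⟩ : ∃ i0 : Fin n, i0.val = k := ⟨⟨k, hk⟩, rfl⟩
    have key : ∀ z t, (t ∈ T ∧ ∀ i, Okk k σ (Function.update y i0 z) t i) ↔
        ((t ∈ T ∧ ∀ i, i ≠ i0 → Okk (k+1) σ y t i) ∧ t i0 ≤ z ∧ z < t i0 + 1) := by
      intro z t
      have hne : ∀ i, i ≠ i0 → (Okk k σ (Function.update y i0 z) t i ↔ Okk (k+1) σ y t i) := by
        intro i hi
        have : i.val ≠ k := fun e => hi (Fin.ext (by omega))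
        have e : (i.val < k) ↔ (i.val < k + 1) := by omega
        simp only [Okk, Function.update_of_ne hi, e]
      have h0 : Okk k σ (Function.update y i0 z) t i0 ↔ (t i0 ≤ z ∧ z < t i0 + 1) := by
        simp [Okk, hi0]
      constructor
      · rintro ⟨a, b⟩
        exact ⟨⟨a, fun i hi => (hne i hi).1 (b i)⟩, h0.1 (b i0)⟩
      · rintro ⟨⟨a, b⟩, c⟩
        refine ⟨a, fun i => ?_⟩
        by_cases hi : i = i0
        · subst hi; exact h0.2 c
        · exact (hne i hi).2 (b i hi)
    obtain ⟨t, ⟨⟨a, b⟩, c⟩, d⟩ := one_dim (fun t => t ∈ T ∧ ∀ i, i ≠ i0 → Okk (k+1) σ y t i)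
      (fun t => t i0) (fun z => by
        have := ih (by omega) σ (Function.update y i0 z)
        simp only [key] at this
        exact this) (σ i0)
    have h1 : ∀ t : Fin n → ℝ, Okk (k+1) σ y t i0 ↔ σ i0 (Int.fract (t i0)) = ⌊t i0⌋ := by
      intro t; simp [Okk, hi0]
    refine ⟨t, ⟨a, fun i => ?_⟩, ?_⟩
    · by_cases hi : i = i0
      · subst hi; exact (h1 t).2 c
      · exact b i hi
    · rintro u ⟨hu, hu'⟩
      exact d u ⟨⟨hu, fun i _ => hu' i⟩, (h1 u).1 (hu' i0)⟩

def Tx {n : ℕ} (T : Set (Fin n → ℝ)) (x : Fin n → P) : Prop :=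
  ∃ t ∈ T, ∀ i, x i = ⟨Int.fract (t i), ⌊t i⌋⟩

theorem keller_of_PP {n : ℕ} (hP : PP n) (T : Set (Fin n → ℝ))
    (h : ∀ y : Fin n → ℝ, ∃ t, (t ∈ T ∧ ∀ i, t i ≤ y i ∧ y i < t i + 1) ∧
      ∀ u, (u ∈ T ∧ ∀ i, u i ≤ y i ∧ y i < u i + 1) → u = t) :
    ∃ s : Fin n → ℝ, ∃ i : Fin n, ∀ k : ℤ, (s + (k : ℝ) • (Pi.single i 1 : Fin n → ℝ)) ∈ T := by
  have tr := transfer T h n le_rfl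
  have ok : ∀ σ : Fin n → S, ∀ y t i, Okk n σ y t i ↔ σ i (Int.fract (t i)) = ⌊t i⌋ := by
    intro σ y t i; simp [Okk]
  simp only [ok] at tr
  have til : TilF (Tx T) := by
    constructor
    · intro σ
      obtain ⟨t, ⟨a, b⟩, -⟩ := tr σ 0
      exact ⟨fun i => ⟨Int.fract (t i), ⌊t i⌋⟩, ⟨t, a, fun i => rfl⟩, fun i => by rw [mP]; exact b i⟩
    · rintro x y ⟨t, ht, hx⟩ ⟨u, hu, hy⟩
      by_contra hne
      simp only [not_or, not_exists] at hne
      obtain ⟨hne, hs⟩ := hne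
      choose σ h1 h2 using fun i => commonP (hs i)
      obtain ⟨w, -, hw⟩ := tr σ 0
      apply hne
      have e1 := hw t ⟨ht, fun i => by have := h1 i; rw [hx, mP] at this; exact this⟩
      have e2 := hw u ⟨hu, fun i => by have := h2 i; rw [hy, mP] at this; exact this⟩
      funext i
      rw [hx, hy, e1, e2]
  have := hP _ til
  unfold NoColF at this
  push Not at this
  obtain ⟨x, i, l, hx⟩ := this
  refine ⟨fun j => if j = i then l else (x j).l + (x j).a, i, fun k => ?_⟩
  obtain ⟨t, ht, e⟩ := hx k
  convert ht using 1
  funext j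
  by_cases hj : j = i
  · subst hj
    have := e j
    rw [Function.update_self] at this
    have e1 := congrArg P.l this
    have e2 := congrArg P.a this
    simp only [lnP] at e1 e2
    rw [← Int.floor_add_fract (t j), ← e1, ← e2]
    simp [lnP, add_comm]
  · have := e j
    rw [Function.update_of_ne hj] at this
    simp [hj, this, Int.fract_add_floor]

theorem tiling_exu {n : ℕ} {T : Set (Fin n → ℝ)}
    (h1 : ∀ s ∈ T, ∀ t ∈ T, s ≠ t → Disjoint {x : Fin n → ℝ | ∀ j, s j ≤ x j ∧ x j < s j + 1}
      {x : Fin n → ℝ | ∀ j, t j ≤ x j ∧ x j < t j + 1})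
    (h2 : (⋃ t ∈ T, {x : Fin n → ℝ | ∀ j, t j ≤ x j ∧ x j < t j + 1}) = Set.univ)
    (y : Fin n → ℝ) : ∃ t, (t ∈ T ∧ ∀ i, t i ≤ y i ∧ y i < t i + 1) ∧
      ∀ u, (u ∈ T ∧ ∀ i, u i ≤ y i ∧ y i < u i + 1) → u = t := by
  have : y ∈ (⋃ t ∈ T, {x : Fin n → ℝ | ∀ j, t j ≤ x j ∧ x j < t j + 1}) := by rw [h2]; trivial
  simp only [Set.mem_iUnion, Set.mem_ofPred_eq] at this
  obtain ⟨t, ht, hy⟩ := this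
  refine ⟨t, ⟨ht, hy⟩, ?_⟩
  rintro u ⟨hu, hu'⟩
  by_contra hne
  exact Set.disjoint_left.1 (h1 u hu t ht hne) hu' hy

theorem PPall {n : ℕ} (hn : 0 < n) (hn6 : n ≤ 6) : PP n := by
  interval_cases n
  · exact PP1
  · exact PP2
  · exact PP3
  · exact PP4
  · exact PP5
  · exact PP6

end Kel

/-- (Main result) For every positive integer `n ≤ 6`, every cube tiling of `ℝⁿ`
contains a column. -/
theorem keller_conjecture_dim_le_six (n : ℕ) (hn : 0 < n) (hn6 : n ≤ 6)
    (T : Set (Fin n → ℝ)) (hT : IsCubeTiling T) :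
    ∃ s : Fin n → ℝ, ∃ i : Fin n, ∀ k : ℤ, (s + (k : ℝ) • (Pi.single i 1 : Fin n → ℝ)) ∈ T := by
  exact Kel.keller_of_PP (Kel.PPall hn hn6) T (fun y => Kel.tiling_exu hT.1 hT.2 y)
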